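/- For every A ≥ 1 there exist constants C₆, C₇, C₈ > 0 depending only on A with the following property. Let n ≥ 2 and let Ω : ℝⁿ∖{0} → ℝ be a measurable odd function that is homogeneous of degree zero (Ω(δx) = Ω(x) for all x ≠ 0 and δ > 0), is integrable on the unit sphere S^{n−1} with ∫_{S^{n−1}} Ω(θ) dσ(θ) = 0, and satisfies ∫_{S^{n−1}} |Ω(θ − ξδ) − Ω(θ)| dσ(θ) ≤ A n δ ∫_{S^{n−1}} |Ω(θ)| dσ(θ) for all ξ ∈ S^{n−1} and 0 < δ < 1/n. Set K(x) := Ω(x)/|x|ⁿ. Then for every measure ν = Σ_{k=1}^N a_k δ_{c_k} with N ∈ ℕ, c_k ∈ ℝⁿ, a_k > 0, and every λ > 0, one has λ · |{x : |Tν(x)| > λ}| ≤ (C₆ + (C₇ max{1, ‖Ω‖_{L¹(S^{n−1},σ)}} + C₈ log n) ‖Ω‖_{L¹(S^{n−1},σ)}) · Σ_{k=1}^N a_k, where Tν(x) := Σ_{k=1}^N a_k K(x − c_k). -/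

import Mathlib

open MeasureTheory Set Metric

section Polar

open scoped ENNReal

variable {n : ℕ}

theorem measurePreserving_polar :
    ∃ e : ({0}ᶜ : Set (EuclideanSpace ℝ (Fin n))) ≃ₜ
        (sphere (0 : EuclideanSpace ℝ (Fin n)) 1 × Ioi (0 : ℝ)),
      MeasurePreserving e ((volume : Measure (EuclideanSpace ℝ (Fin n))).comap (↑))
        ((volume : Measure (EuclideanSpace ℝ (Fin n))).toSphere.prod (.volumeIoiPow (n - 1))) ∧
      ∀ x, ((e x).2 : ℝ) • ((e x).1 : EuclideanSpace ℝ (Fin n)) = x := by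
  refine ⟨homeomorphUnitSphereProd _, ?_, fun x => ?_⟩
  · simpa using (volume : Measure (EuclideanSpace ℝ (Fin n))).measurePreserving_homeomorphUnitSphereProd
  · have : ‖(x : EuclideanSpace ℝ (Fin n))‖ ≠ 0 := norm_ne_zero_iff.2 x.2
    simp [smul_smul, this]

theorem lintegral_volumeIoiPow (m : ℕ) {f : ℝ → ℝ≥0∞} (hf : Measurable f) :
    ∫⁻ r : Ioi (0 : ℝ), f r ∂(.volumeIoiPow m) =
      ∫⁻ r in Ioi (0 : ℝ), ENNReal.ofReal (r ^ m) * f r := by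
  rw [Measure.volumeIoiPow, lintegral_withDensity_eq_lintegral_mul _ (by fun_prop) (by fun_prop)]
  exact lintegral_subtype_comap measurableSet_Ioi (fun r => ENNReal.ofReal (r ^ m) * f r)

/-- Integration in polar coordinates for nonnegative functions. -/
theorem lintegral_polar (hn : 1 ≤ n) {f : EuclideanSpace ℝ (Fin n) → ℝ≥0∞} (hf : Measurable f) :
    ∫⁻ x, f x = ∫⁻ r in Ioi (0 : ℝ), ENNReal.ofReal (r ^ (n - 1)) *
      ∫⁻ θ : sphere (0 : EuclideanSpace ℝ (Fin n)) 1, f (r • (θ : EuclideanSpace ℝ (Fin n)))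
        ∂(volume : Measure (EuclideanSpace ℝ (Fin n))).toSphere := by
  have : Nonempty (Fin n) := ⟨⟨0, hn⟩⟩
  obtain ⟨e, he, hx⟩ := measurePreserving_polar (n := n)
  have hmeas : Measurable fun p : sphere (0 : EuclideanSpace ℝ (Fin n)) 1 × ℝ =>
      f (p.2 • (p.1 : EuclideanSpace ℝ (Fin n))) := by fun_prop
  have hmeas' : Measurable fun p : sphere (0 : EuclideanSpace ℝ (Fin n)) 1 × Ioi (0 : ℝ) =>
      f ((p.2 : ℝ) • (p.1 : EuclideanSpace ℝ (Fin n))) := by fun_prop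
  rw [← lintegral_volumeIoiPow (n - 1) (f := fun r => ∫⁻ θ : sphere (0 : EuclideanSpace ℝ (Fin n)) 1,
    f (r • (θ : EuclideanSpace ℝ (Fin n))) ∂(volume : Measure (EuclideanSpace ℝ (Fin n))).toSphere)
    (Measurable.lintegral_prod_left' hmeas), ← lintegral_prod_symm' _ hmeas',
    ← he.lintegral_comp_emb e.measurableEmbedding, ← setLIntegral_univ (μ := volume)]
  simp only [hx]
  rw [lintegral_subtype_comap (measurableSet_singleton _).compl, restrict_compl_singleton,
    Measure.restrict_univ]

/-- Integration in polar coordinates, the angular variable being the outer one. -/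
theorem integral_polar (hn : 1 ≤ n) {f : EuclideanSpace ℝ (Fin n) → ℝ} (hf : Integrable f) :
    ∫ x, f x = ∫ θ : sphere (0 : EuclideanSpace ℝ (Fin n)) 1,
      (∫ r in Ioi (0 : ℝ), r ^ (n - 1) * f (r • (θ : EuclideanSpace ℝ (Fin n))))
        ∂(volume : Measure (EuclideanSpace ℝ (Fin n))).toSphere := by
  have : Nonempty (Fin n) := ⟨⟨0, hn⟩⟩
  obtain ⟨e, he, hx⟩ := measurePreserving_polar (n := n)
  set g : sphere (0 : EuclideanSpace ℝ (Fin n)) 1 × Ioi (0 : ℝ) → ℝ :=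
    fun p => f ((p.2 : ℝ) • (p.1 : EuclideanSpace ℝ (Fin n))) with hg
  have hge : g ∘ e = fun x : ({0}ᶜ : Set (EuclideanSpace ℝ (Fin n))) => f x := by
    ext x
    simp [hg, hx]
  have hint : Integrable g
      ((volume : Measure (EuclideanSpace ℝ (Fin n))).toSphere.prod (.volumeIoiPow (n - 1))) := by
    rw [← he.integrable_comp_emb e.measurableEmbedding, hge]
    exact (integrableOn_iff_comap_subtypeVal (measurableSet_singleton _).compl).1 hf.integrableOn
  calc ∫ x, f x = ∫ x : ({0}ᶜ : Set (EuclideanSpace ℝ (Fin n))), f x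
        ∂((volume : Measure (EuclideanSpace ℝ (Fin n))).comap (↑)) := by
        rw [integral_subtype_comap (measurableSet_singleton _).compl f, restrict_compl_singleton]
    _ = ∫ p, g p ∂((volume : Measure (EuclideanSpace ℝ (Fin n))).toSphere.prod
          (.volumeIoiPow (n - 1))) := by
        rw [← he.integral_comp e.measurableEmbedding]
        exact congrArg (fun h => integral _ h) hge.symm
    _ = _ := by
        rw [integral_prod _ hint]
        refine integral_congr_ae (.of_forall fun θ => ?_)
        simp only [Measure.volumeIoiPow, ENNReal.ofReal, hg]
        rw [integral_withDensity_eq_integral_smul (by fun_prop),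
          integral_subtype_comap measurableSet_Ioi fun r : ℝ =>
            Real.toNNReal (r ^ (n - 1)) • f (r • (θ : EuclideanSpace ℝ (Fin n)))]
        refine setIntegral_congr_fun measurableSet_Ioi fun r hr => ?_
        simp only [NNReal.smul_def, Real.coe_toNNReal _ (pow_nonneg (le_of_lt hr) _), smul_eq_mul]

end Polar

section Plancherel

open scoped ENNReal FourierTransform SchwartzMap ContDiff

variable {E : Type*} [NormedAddCommGroup E] [InnerProductSpace ℝ E] [FiniteDimensional ℝ E]
  [MeasurableSpace E] [BorelSpace E]

/-- The Fourier integral of an integrable, square-integrable function represents its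
`L²` Fourier transform. -/
theorem fourier_toLp_ae_eq {f : E → ℂ} (hf : Integrable f) (hf2 : MemLp f 2) :
    (𝓕 (hf2.toLp f) : Lp ℂ 2 (volume : Measure E)) =ᵐ[volume] 𝓕 f := by
  have hcont : Continuous (𝓕 f) :=
    VectorFourier.fourierIntegral_continuous Real.continuous_fourierChar
      (by exact continuous_inner) hf
  refine ae_eq_of_integral_contDiff_smul_eq
    ((Lp.memLp _).locallyIntegrable (by norm_num)) hcont.locallyIntegrable fun g hg hgs => ?_
  have hgs' : HasCompactSupport (fun x => (g x : ℂ)) := hgs.comp_left (g := Complex.ofReal) rfl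
  have hg' : ContDiff ℝ ∞ (fun x => (g x : ℂ)) := Complex.ofRealCLM.contDiff.comp hg
  let φ : 𝓢(E, ℂ) := hgs'.toSchwartzMap hg'
  have hφ : ∀ x, φ x = (g x : ℂ) := fun x => rfl
  have key := DFunLike.congr_fun (Lp.fourier_toTemperedDistribution_eq (hf2.toLp f)) φ
  rw [TemperedDistribution.fourier_apply, Lp.toTemperedDistribution_apply,
    Lp.toTemperedDistribution_apply] at key
  have h1 : ∫ x, φ x • (𝓕 (hf2.toLp f) : Lp ℂ 2 (volume : Measure E)) x
      = ∫ x, g x • (𝓕 (hf2.toLp f) : Lp ℂ 2 (volume : Measure E)) x := by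
    simp only [hφ]; rfl
  have h2 : ∫ x, (𝓕 φ) x • (hf2.toLp f) x = ∫ x, (𝓕 φ) x • f x := by
    refine integral_congr_ae ?_
    filter_upwards [hf2.coeFn_toLp] with x hx
    rw [hx]
  rw [← h1, ← key, h2]
  have h3 := VectorFourier.integral_fourierIntegral_smul_eq_flip (L := innerₗ E) (μ := volume)
    (ν := volume) (f := φ) (g := f) Real.continuous_fourierChar (by exact continuous_inner)
    φ.integrable hf
  rw [SchwartzMap.fourier_coe]
  refine Eq.trans h3 ?_
  rw [flip_innerₗ]
  simp only [hφ]
  rfl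

theorem eLpNorm_fourier_eq {f : E → ℂ} (hf : Integrable f) (hf2 : MemLp f 2) :
    eLpNorm (𝓕 f) 2 = eLpNorm f 2 := by
  have h := Lp.norm_fourier_eq (hf2.toLp f)
  rw [Lp.norm_def, Lp.norm_def, ENNReal.toReal_eq_toReal_iff' (Lp.eLpNorm_ne_top _)
    (Lp.eLpNorm_ne_top _), eLpNorm_congr_ae (fourier_toLp_ae_eq hf hf2),
    eLpNorm_congr_ae hf2.coeFn_toLp] at h
  exact h

open scoped Convolution in
/-- Convolution with an integrable kernel whose Fourier transform is bounded by `B` has norm at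
most `B` on `L²`. -/
theorem eLpNorm_convolution_le_of_fourier_le {k f : E → ℂ} (hk : Integrable k) {B : ℝ}
    (hB : ∀ ξ, ‖𝓕 k ξ‖ ≤ B) (hf : Integrable f) (hf2 : MemLp f 2)
    (hkf : MemLp (k ⋆[ContinuousLinearMap.mul ℂ ℂ] f) 2) :
    eLpNorm (k ⋆[ContinuousLinearMap.mul ℂ ℂ] f) 2 ≤ ENNReal.ofReal B * eLpNorm f 2 := by
  have hint : Integrable (k ⋆[ContinuousLinearMap.mul ℂ ℂ] f) := hk.integrable_convolution _ hf
  rw [← eLpNorm_fourier_eq hint hkf, ← eLpNorm_fourier_eq hf hf2]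
  refine eLpNorm_le_mul_eLpNorm_of_ae_le_mul (.of_forall fun ξ => ?_) 2
  rw [Real.fourier_mul_convolution_eq hk hf, norm_mul]
  exact mul_le_mul_of_nonneg_right (hB ξ) (norm_nonneg _)

end Plancherel

/-- The kernel `Ω(x) / |x| ^ n`. -/
noncomputable def homogeneousKernel {n : ℕ} (Ω : EuclideanSpace ℝ (Fin n) → ℝ)
    (x : EuclideanSpace ℝ (Fin n)) : ℝ :=
  Ω x / ‖x‖ ^ n

/-- The `L¹` norm of `Ω` on the unit sphere. -/
noncomputable def sphereL1Norm {n : ℕ} (Ω : EuclideanSpace ℝ (Fin n) → ℝ) : ℝ :=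
  ∫ θ : sphere (0 : EuclideanSpace ℝ (Fin n)) 1, |Ω θ|
    ∂(volume : Measure (EuclideanSpace ℝ (Fin n))).toSphere

section Kernel

open scoped ENNReal

variable {n : ℕ} {Ω : EuclideanSpace ℝ (Fin n) → ℝ}

theorem sphereL1Norm_nonneg : 0 ≤ sphereL1Norm Ω :=
  integral_nonneg fun _ => abs_nonneg _

theorem measurable_homogeneousKernel (hΩ : Measurable Ω) : Measurable (homogeneousKernel Ω) := by
  unfold homogeneousKernel
  fun_prop

theorem homogeneousKernel_smul_sphere
    (hhom : ∀ x : EuclideanSpace ℝ (Fin n), x ≠ 0 → ∀ δ : ℝ, 0 < δ → Ω (δ • x) = Ω x)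
    {r : ℝ} (hr : 0 < r) (θ : sphere (0 : EuclideanSpace ℝ (Fin n)) 1) :
    homogeneousKernel Ω (r • (θ : EuclideanSpace ℝ (Fin n))) = Ω θ / r ^ n := by
  have hθ : ‖(θ : EuclideanSpace ℝ (Fin n))‖ = 1 := by simp
  rw [homogeneousKernel, hhom _ (by intro h; simp [h] at hθ) r hr, norm_smul, hθ, mul_one,
    Real.norm_of_nonneg hr.le]

theorem homogeneousKernel_neg
    (hodd : ∀ x : EuclideanSpace ℝ (Fin n), x ≠ 0 → Ω (-x) = -Ω x)
    {x : EuclideanSpace ℝ (Fin n)} (hx : x ≠ 0) :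
    homogeneousKernel Ω (-x) = -homogeneousKernel Ω x := by
  simp [homogeneousKernel, hodd x hx, neg_div]

theorem lintegral_sphere_enorm
    (hint : Integrable (fun θ : sphere (0 : EuclideanSpace ℝ (Fin n)) 1 => Ω θ)
        (volume : Measure (EuclideanSpace ℝ (Fin n))).toSphere) :
    ∫⁻ θ : sphere (0 : EuclideanSpace ℝ (Fin n)) 1, ‖Ω θ‖ₑ
      ∂(volume : Measure (EuclideanSpace ℝ (Fin n))).toSphere = ENNReal.ofReal (sphereL1Norm Ω) :=
  (ofReal_integral_norm_eq_lintegral_enorm hint).symm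

theorem ofReal_pow_mul_ofReal_inv_pow (hn : 1 ≤ n) {r : ℝ} (hr : 0 < r) :
    ENNReal.ofReal (r ^ (n - 1)) * ENNReal.ofReal ((r ^ n)⁻¹) = ENNReal.ofReal r⁻¹ := by
  rw [← ENNReal.ofReal_mul (by positivity)]
  congr 1
  obtain ⟨m, rfl⟩ : ∃ m, n = m + 1 := ⟨n - 1, by omega⟩
  rw [Nat.add_sub_cancel, pow_succ]
  field_simp

/-- The kernel against a radial weight. -/
theorem lintegral_homogeneousKernel_mul_radial (hn : 1 ≤ n) (hΩ : Measurable Ω)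
    (hhom : ∀ x : EuclideanSpace ℝ (Fin n), x ≠ 0 → ∀ δ : ℝ, 0 < δ → Ω (δ • x) = Ω x)
    (hint : Integrable (fun θ : sphere (0 : EuclideanSpace ℝ (Fin n)) 1 => Ω θ)
        (volume : Measure (EuclideanSpace ℝ (Fin n))).toSphere)
    {g : ℝ → ℝ≥0∞} (hg : Measurable g) :
    ∫⁻ x, ‖homogeneousKernel Ω x‖ₑ * g ‖x‖ =
      ENNReal.ofReal (sphereL1Norm Ω) * ∫⁻ r in Ioi (0 : ℝ), ENNReal.ofReal r⁻¹ * g r := by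
  have hK := measurable_homogeneousKernel hΩ
  rw [lintegral_polar hn (by fun_prop), ← lintegral_const_mul _ (by fun_prop)]
  refine setLIntegral_congr_fun measurableSet_Ioi fun r (hr : 0 < r) => ?_
  have h1 : ∀ θ : sphere (0 : EuclideanSpace ℝ (Fin n)) 1,
      ‖homogeneousKernel Ω (r • (θ : EuclideanSpace ℝ (Fin n)))‖ₑ *
        g ‖r • (θ : EuclideanSpace ℝ (Fin n))‖ =
      ‖Ω θ‖ₑ * (ENNReal.ofReal ((r ^ n)⁻¹) * g r) := fun θ => by
    rw [homogeneousKernel_smul_sphere hhom hr, norm_smul, Real.norm_of_nonneg hr.le,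
      show ‖(θ : EuclideanSpace ℝ (Fin n))‖ = 1 by simp, mul_one, div_eq_mul_inv, enorm_mul,
      Real.enorm_of_nonneg (inv_nonneg.2 (pow_nonneg hr.le n)), mul_assoc]
  simp only [h1]
  rw [lintegral_mul_const _ (by fun_prop), lintegral_sphere_enorm hint,
    ← ofReal_pow_mul_ofReal_inv_pow hn hr]
  ring

theorem setLIntegral_homogeneousKernel_annulus (hn : 1 ≤ n) (hΩ : Measurable Ω)
    (hhom : ∀ x : EuclideanSpace ℝ (Fin n), x ≠ 0 → ∀ δ : ℝ, 0 < δ → Ω (δ • x) = Ω x)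
    (hint : Integrable (fun θ : sphere (0 : EuclideanSpace ℝ (Fin n)) 1 => Ω θ)
        (volume : Measure (EuclideanSpace ℝ (Fin n))).toSphere)
    {s L : ℝ} (hs : 0 < s) (hsL : s ≤ L) :
    ∫⁻ x in {x | s ≤ ‖x‖ ∧ ‖x‖ ≤ L}, ‖homogeneousKernel Ω x‖ₑ =
      ENNReal.ofReal (sphereL1Norm Ω * Real.log (L / s)) := by
  have hm : MeasurableSet {x : EuclideanSpace ℝ (Fin n) | s ≤ ‖x‖ ∧ ‖x‖ ≤ L} :=
    measurable_norm (measurableSet_Icc (a := s) (b := L))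
  have := lintegral_homogeneousKernel_mul_radial hn hΩ hhom hint
    (g := (Icc s L).indicator 1) (measurable_one.indicator measurableSet_Icc)
  rw [← lintegral_indicator hm]
  convert this using 1
  · refine lintegral_congr fun x => ?_
    by_cases hx : s ≤ ‖x‖ ∧ ‖x‖ ≤ L <;> simp [indicator, hx]
  · rw [ENNReal.ofReal_mul sphereL1Norm_nonneg]
    congr 1
    have h2 : ∀ r : ℝ, ENNReal.ofReal r⁻¹ * (Icc s L).indicator 1 r =
        (Icc s L).indicator (fun r => ENNReal.ofReal r⁻¹) r := fun r => by
      by_cases hr : r ∈ Icc s L <;> simp [hr]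
    simp only [h2]
    rw [setLIntegral_indicator measurableSet_Icc,
      inter_eq_left.2 (show Icc s L ⊆ Ioi 0 from fun r hr => hs.trans_le hr.1),
      ← integral_inv_of_pos hs (hs.trans_le hsL), intervalIntegral.integral_of_le hsL,
      ← integral_Icc_eq_integral_Ioc, ofReal_integral_eq_lintegral_ofReal]
    · exact (continuousOn_inv₀.mono fun r hr => (hs.trans_le hr.1).ne').integrableOn_Icc
    · filter_upwards [ae_restrict_mem measurableSet_Icc] with r hr
      exact inv_nonneg.2 (hs.le.trans hr.1)

theorem setLIntegral_homogeneousKernel_mul_norm (hn : 1 ≤ n) (hΩ : Measurable Ω)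
    (hhom : ∀ x : EuclideanSpace ℝ (Fin n), x ≠ 0 → ∀ δ : ℝ, 0 < δ → Ω (δ • x) = Ω x)
    (hint : Integrable (fun θ : sphere (0 : EuclideanSpace ℝ (Fin n)) 1 => Ω θ)
        (volume : Measure (EuclideanSpace ℝ (Fin n))).toSphere) (s : ℝ) :
    ∫⁻ x in {x | ‖x‖ < s}, ‖homogeneousKernel Ω x‖ₑ * ENNReal.ofReal ‖x‖ =
      ENNReal.ofReal (sphereL1Norm Ω * s) := by
  have hm : MeasurableSet {x : EuclideanSpace ℝ (Fin n) | ‖x‖ < s} :=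
    measurable_norm (measurableSet_Iio (a := s))
  have := lintegral_homogeneousKernel_mul_radial hn hΩ hhom hint
    (g := (Iio s).indicator fun r => ENNReal.ofReal r)
    (ENNReal.measurable_ofReal.indicator measurableSet_Iio)
  rw [← lintegral_indicator hm]
  convert this using 1
  · refine lintegral_congr fun x => ?_
    by_cases hx : ‖x‖ < s <;> simp [indicator, hx]
  · rw [ENNReal.ofReal_mul sphereL1Norm_nonneg]
    congr 1
    have h2 : ∀ r ∈ Ioi (0 : ℝ), ENNReal.ofReal r⁻¹ *
        (Iio s).indicator (fun r => ENNReal.ofReal r) r = (Iio s).indicator 1 r := fun r hr => by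
      by_cases h : r ∈ Iio s
      · have hr : 0 < r := hr
        simp [h, ← ENNReal.ofReal_mul (inv_nonneg.2 hr.le), hr.ne']
      · simp [h]
    rw [setLIntegral_congr_fun measurableSet_Ioi h2, setLIntegral_indicator measurableSet_Iio,
      inter_comm, Ioi_inter_Iio]
    simp

theorem lintegral_Ioi_inv_sq {R : ℝ} (hR : 0 < R) :
    ∫⁻ r in Ioi R, ENNReal.ofReal (r ^ (-2 : ℝ)) = ENNReal.ofReal R⁻¹ := by
  rw [← ofReal_integral_eq_lintegral_ofReal (integrableOn_Ioi_rpow_of_lt (by norm_num) hR),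
    integral_Ioi_rpow_of_lt (by norm_num) hR]
  · norm_num [Real.rpow_neg_one]
  · filter_upwards [ae_restrict_mem measurableSet_Ioi] with r hr
    exact Real.rpow_nonneg (hR.trans hr).le _

theorem setLIntegral_homogeneousKernel_mul_inv_norm (hn : 1 ≤ n) (hΩ : Measurable Ω)
    (hhom : ∀ x : EuclideanSpace ℝ (Fin n), x ≠ 0 → ∀ δ : ℝ, 0 < δ → Ω (δ • x) = Ω x)
    (hint : Integrable (fun θ : sphere (0 : EuclideanSpace ℝ (Fin n)) 1 => Ω θ)
        (volume : Measure (EuclideanSpace ℝ (Fin n))).toSphere)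
    {R : ℝ} (hR : 0 < R) :
    ∫⁻ x in {x | R < ‖x‖}, ‖homogeneousKernel Ω x‖ₑ * ENNReal.ofReal ‖x‖⁻¹ =
      ENNReal.ofReal (sphereL1Norm Ω / R) := by
  have hm : MeasurableSet {x : EuclideanSpace ℝ (Fin n) | R < ‖x‖} :=
    measurable_norm (measurableSet_Ioi (a := R))
  have := lintegral_homogeneousKernel_mul_radial hn hΩ hhom hint
    (g := (Ioi R).indicator fun r => ENNReal.ofReal r⁻¹)
    ((by fun_prop : Measurable fun r : ℝ => ENNReal.ofReal r⁻¹).indicator measurableSet_Ioi)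
  rw [← lintegral_indicator hm]
  convert this using 1
  · refine lintegral_congr fun x => ?_
    by_cases hx : R < ‖x‖ <;> simp [indicator, hx]
  · rw [div_eq_mul_inv, ENNReal.ofReal_mul sphereL1Norm_nonneg]
    congr 1
    rw [← lintegral_Ioi_inv_sq hR]
    have h2 : ∀ r ∈ Ioi (0 : ℝ), ENNReal.ofReal r⁻¹ *
        (Ioi R).indicator (fun r => ENNReal.ofReal r⁻¹) r =
        (Ioi R).indicator (fun r => ENNReal.ofReal (r ^ (-2 : ℝ))) r := fun r hr => by
      by_cases h : r ∈ Ioi R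
      · have hr : 0 < r := hr
        simp only [h, indicator_of_mem]
        rw [← ENNReal.ofReal_mul (inv_nonneg.2 hr.le), Real.rpow_neg hr.le]
        norm_num [sq]
      · simp [h]
    rw [setLIntegral_congr_fun measurableSet_Ioi h2, setLIntegral_indicator measurableSet_Ioi,
      inter_eq_left.2 (Ioi_subset_Ioi hR.le)]

end Kernel

section Hormander

open scoped ENNReal

variable {n : ℕ} {Ω : EuclideanSpace ℝ (Fin n) → ℝ}

theorem inv_pow_bounds_of_near_one {u τ : ℝ} (hu : |u - 1| ≤ τ) (hτ : 2 * n * τ ≤ 1) (hn : 1 ≤ n) :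
    (u ^ n)⁻¹ ≤ 2 ∧ |(u ^ n)⁻¹ - 1| ≤ 2 * n * τ := by
  have hn' : (1 : ℝ) ≤ n := by exact_mod_cast hn
  have hτ0 : 0 ≤ τ := (abs_nonneg _).trans hu
  obtain ⟨h1, h2⟩ := abs_le.1 hu
  have hτ1 : τ ≤ 1 / 2 := by nlinarith
  have hb : 1 - n * τ ≤ (1 - τ) ^ n := by
    have := one_add_mul_le_pow (a := -τ) (by linarith) n
    rw [← sub_eq_add_neg] at this
    linarith
  have hlow : 1 - n * τ ≤ u ^ n :=
    hb.trans (pow_le_pow_left₀ (by linarith) (by linarith) n)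
  have hpos : 0 < 1 - n * τ := by nlinarith
  have hup : (u ^ n)⁻¹ ≤ 1 + 2 * n * τ := by
    refine (inv_anti₀ hpos hlow).trans ?_
    rw [inv_le_iff_one_le_mul₀ hpos]
    nlinarith [mul_nonneg (by linarith : (0 : ℝ) ≤ n) hτ0]
  have hdown : 1 - n * τ ≤ (u ^ n)⁻¹ := by
    refine hb.trans ?_
    rw [le_inv_comm₀ (pow_pos (by linarith) n) (hpos.trans_le hlow), ← inv_pow]
    refine pow_le_pow_left₀ (by linarith) ?_ n
    rw [le_inv_comm₀ (by linarith) (by linarith), inv_eq_one_div, le_div_iff₀ (by linarith)]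
    nlinarith
  refine ⟨by linarith, abs_le.2 ⟨?_, by linarith⟩⟩
  nlinarith [mul_nonneg (by linarith : (0 : ℝ) ≤ n) hτ0]

theorem inv_pow_bounds_of_near {a b t : ℝ} (hb : 0 < b) (hab : |a - b| ≤ t)
    (ht : 2 * n * t ≤ b) (hn : 1 ≤ n) :
    (a ^ n)⁻¹ ≤ 2 * (b ^ n)⁻¹ ∧ |(a ^ n)⁻¹ - (b ^ n)⁻¹| ≤ 2 * n * t * ((b ^ n)⁻¹ * b⁻¹) := by
  have hu : |a / b - 1| ≤ t / b := by
    rw [div_sub_one hb.ne', abs_div, abs_of_pos hb]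
    exact div_le_div_of_nonneg_right hab hb.le
  obtain ⟨h1, h2⟩ := inv_pow_bounds_of_near_one (n := n) hu
    (by rw [← mul_div_assoc, div_le_one hb]; exact ht) hn
  have hbn : 0 < (b ^ n)⁻¹ := by positivity
  have e : (a ^ n)⁻¹ = ((a / b) ^ n)⁻¹ * (b ^ n)⁻¹ := by
    rw [div_pow, inv_div]
    field_simp
  rw [e]
  refine ⟨mul_le_mul_of_nonneg_right h1 hbn.le, ?_⟩
  rw [← sub_one_mul, abs_mul, abs_of_pos hbn]
  calc _ ≤ 2 * n * (t / b) * (b ^ n)⁻¹ := mul_le_mul_of_nonneg_right h2 hbn.le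
    _ = _ := by rw [div_eq_mul_inv]; ring

theorem abs_homogeneousKernel_sub_le (hn : 1 ≤ n) {x y : EuclideanSpace ℝ (Fin n)} (hx : x ≠ 0)
    (hxy : 2 * n * ‖y‖ ≤ ‖x‖) :
    |homogeneousKernel Ω (x - y) - homogeneousKernel Ω x| ≤
      2 * (|Ω (x - y) - Ω x| * (‖x‖ ^ n)⁻¹) +
        2 * n * ‖y‖ * (|homogeneousKernel Ω x| * ‖x‖⁻¹) := by
  have hx' : 0 < ‖x‖ := norm_pos_iff.2 hx
  obtain ⟨h1, h2⟩ := inv_pow_bounds_of_near (n := n) hx' (a := ‖x - y‖) (t := ‖y‖)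
    (by simpa using abs_norm_sub_norm_le (x - y) x) hxy hn
  simp only [homogeneousKernel, div_eq_mul_inv, abs_mul]
  rw [show Ω (x - y) * (‖x - y‖ ^ n)⁻¹ - Ω x * (‖x‖ ^ n)⁻¹ =
    (Ω (x - y) - Ω x) * (‖x - y‖ ^ n)⁻¹ + Ω x * ((‖x - y‖ ^ n)⁻¹ - (‖x‖ ^ n)⁻¹) by ring]
  refine (abs_add_le _ _).trans (add_le_add ?_ ?_)
  · rw [abs_mul, abs_of_nonneg (by positivity : 0 ≤ (‖x - y‖ ^ n)⁻¹)]
    nlinarith [mul_le_mul_of_nonneg_left h1 (abs_nonneg (Ω (x - y) - Ω x))]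
  · rw [abs_mul, abs_of_nonneg (by positivity : 0 ≤ (‖x‖ ^ n)⁻¹)]
    nlinarith [mul_le_mul_of_nonneg_left h2 (abs_nonneg (Ω x))]

/-- Almost every sphere of a translate sees an integrable angular part. -/
theorem ae_lintegral_sphere_translate_lt_top (hn : 1 ≤ n) (hΩ : Measurable Ω)
    (hhom : ∀ x : EuclideanSpace ℝ (Fin n), x ≠ 0 → ∀ δ : ℝ, 0 < δ → Ω (δ • x) = Ω x)
    (hint : Integrable (fun θ : sphere (0 : EuclideanSpace ℝ (Fin n)) 1 => Ω θ)
        (volume : Measure (EuclideanSpace ℝ (Fin n))).toSphere)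
    {y : EuclideanSpace ℝ (Fin n)} {R : ℝ} (hyR : ‖y‖ < R) :
    ∀ᵐ r ∂(volume.restrict (Ioi R)),
      ∫⁻ θ : sphere (0 : EuclideanSpace ℝ (Fin n)) 1,
        ‖Ω (r • (θ : EuclideanSpace ℝ (Fin n)) - y)‖ₑ
        ∂(volume : Measure (EuclideanSpace ℝ (Fin n))).toSphere < ⊤ := by
  have hR : 0 < R := (norm_nonneg y).trans_lt hyR
  have key : ∀ m : ℕ, ∀ᵐ r : ℝ ∂(volume.restrict (Ioi R)), r ≤ m →
      ∫⁻ θ : sphere (0 : EuclideanSpace ℝ (Fin n)) 1,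
        ‖Ω (r • (θ : EuclideanSpace ℝ (Fin n)) - y)‖ₑ
        ∂(volume : Measure (EuclideanSpace ℝ (Fin n))).toSphere < ⊤ := by
    intro m
    set G : EuclideanSpace ℝ (Fin n) → ℝ≥0∞ :=
      {x | R < ‖x‖ ∧ ‖x‖ ≤ m}.indicator fun x => ‖Ω (x - y)‖ₑ with hG
    have hms : MeasurableSet {x : EuclideanSpace ℝ (Fin n) | R < ‖x‖ ∧ ‖x‖ ≤ m} :=
      measurable_norm (measurableSet_Ioc (a := R) (b := (m : ℝ)))
    have hGm : Measurable G := Measurable.indicator (by fun_prop) hms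
    have hGint : ∫⁻ x, G x < ⊤ := by
      set T : Set (EuclideanSpace ℝ (Fin n)) := {x | R - ‖y‖ ≤ ‖x‖ ∧ ‖x‖ ≤ R + m + ‖y‖} with hT
      have hmT : MeasurableSet T :=
        measurable_norm (measurableSet_Icc (a := R - ‖y‖) (b := R + m + ‖y‖))
      have hle : ∀ x, G x ≤ ENNReal.ofReal ((R + m + ‖y‖) ^ n) *
          T.indicator (fun x => ‖homogeneousKernel Ω x‖ₑ) (x - y) := by
        intro x
        by_cases hx : R < ‖x‖ ∧ ‖x‖ ≤ m
        · have h1 : R - ‖y‖ ≤ ‖x - y‖ := by linarith [norm_sub_norm_le x y, hx.1]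
          have h2 : ‖x - y‖ ≤ R + m + ‖y‖ := by linarith [norm_sub_le x y, hx.2]
          have h3 : 0 < ‖x - y‖ := by linarith
          rw [hG, indicator_of_mem (by exact hx), indicator_of_mem (by exact ⟨h1, h2⟩),
            show Ω (x - y) = ‖x - y‖ ^ n * homogeneousKernel Ω (x - y) by
              rw [homogeneousKernel]; field_simp, enorm_mul,
            Real.enorm_of_nonneg (by positivity)]
          gcongr
        · rw [hG, indicator_of_notMem (by exact hx)]
          exact zero_le
      refine (lintegral_mono hle).trans_lt ?_
      rw [lintegral_const_mul _ (by
        exact ((measurable_homogeneousKernel hΩ).enorm.indicator hmT).comp (by fun_prop)),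
        lintegral_sub_right_eq_self
          (fun x => T.indicator (fun x => ‖homogeneousKernel Ω x‖ₑ) x) y,
        lintegral_indicator hmT, setLIntegral_homogeneousKernel_annulus hn hΩ hhom hint
          (by linarith) (by linarith [m.cast_nonneg (α := ℝ), norm_nonneg y])]
      exact ENNReal.mul_lt_top ENNReal.ofReal_lt_top ENNReal.ofReal_lt_top
    rw [lintegral_polar hn hGm] at hGint
    have hae := ae_lt_top' (by
      refine (Measurable.mul (by fun_prop) ?_).aemeasurable
      exact Measurable.lintegral_prod_left' (f := fun p : sphere (0 : EuclideanSpace ℝ (Fin n)) 1 × ℝ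
        => G (p.2 • (p.1 : EuclideanSpace ℝ (Fin n)))) (by fun_prop)) hGint.ne
    rw [ae_restrict_iff' measurableSet_Ioi] at hae ⊢
    filter_upwards [hae] with r hr hrR hrm
    have hrR : R < r := hrR
    have hr0 : 0 < r := hR.trans hrR
    have h4 := hr hr0
    have h5 : ∀ θ : sphere (0 : EuclideanSpace ℝ (Fin n)) 1,
        G (r • (θ : EuclideanSpace ℝ (Fin n))) =
          ‖Ω (r • (θ : EuclideanSpace ℝ (Fin n)) - y)‖ₑ := fun θ => by
      rw [hG, indicator_of_mem]
      simp [norm_smul, abs_of_pos hr0, hrR, hrm]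
    simp only [h5] at h4
    by_contra hcon
    rw [not_lt, top_le_iff] at hcon
    rw [hcon, ENNReal.mul_top (by simpa using pow_pos hr0 _)] at h4
    exact lt_irrefl _ h4
  filter_upwards [ae_all_iff.2 key] with r hr
  obtain ⟨m, hm⟩ := exists_nat_ge r
  exact hr m hm

/-- The smoothness hypothesis on the sphere, integrated against `|x| ^ (-n)`. -/
theorem setLIntegral_angular_sub_le (hn : 1 ≤ n) (hΩ : Measurable Ω)
    (hhom : ∀ x : EuclideanSpace ℝ (Fin n), x ≠ 0 → ∀ δ : ℝ, 0 < δ → Ω (δ • x) = Ω x)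
    (hint : Integrable (fun θ : sphere (0 : EuclideanSpace ℝ (Fin n)) 1 => Ω θ)
        (volume : Measure (EuclideanSpace ℝ (Fin n))).toSphere)
    {A : ℝ} (hA : 0 ≤ A)
    (hsm : ∀ ξ : EuclideanSpace ℝ (Fin n), ‖ξ‖ = 1 → ∀ δ : ℝ, 0 < δ → δ < 1 / n →
        (∫ θ : sphere (0 : EuclideanSpace ℝ (Fin n)) 1,
            |Ω ((θ : EuclideanSpace ℝ (Fin n)) - δ • ξ) - Ω θ|
            ∂(volume : Measure (EuclideanSpace ℝ (Fin n))).toSphere) ≤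
          A * n * δ * sphereL1Norm Ω)
    {y : EuclideanSpace ℝ (Fin n)} {R : ℝ} (hR : 0 < R) (hyR : 2 * n * ‖y‖ ≤ R) :
    ∫⁻ x in {x | R < ‖x‖}, ‖Ω (x - y) - Ω x‖ₑ * ENNReal.ofReal ((‖x‖ ^ n)⁻¹) ≤
      ENNReal.ofReal (A * n * ‖y‖ * sphereL1Norm Ω / R) := by
  rcases eq_or_ne y 0 with rfl | hy
  · simp
  have hy' : 0 < ‖y‖ := norm_pos_iff.2 hy
  have hn' : (1 : ℝ) ≤ n := by exact_mod_cast hn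
  have hyR' : ‖y‖ < R := by nlinarith
  have hm : MeasurableSet {x : EuclideanSpace ℝ (Fin n) | R < ‖x‖} :=
    measurable_norm (measurableSet_Ioi (a := R))
  rw [← lintegral_indicator hm, lintegral_polar hn (Measurable.indicator (by fun_prop) hm)]
  have hsub : ∫⁻ r in Ioi (0 : ℝ), ENNReal.ofReal (r ^ (n - 1)) *
      ∫⁻ θ : sphere (0 : EuclideanSpace ℝ (Fin n)) 1,
        {x | R < ‖x‖}.indicator
          (fun x => ‖Ω (x - y) - Ω x‖ₑ * ENNReal.ofReal ((‖x‖ ^ n)⁻¹))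
          (r • (θ : EuclideanSpace ℝ (Fin n)))
        ∂(volume : Measure (EuclideanSpace ℝ (Fin n))).toSphere =
      ∫⁻ r in Ioi R, ENNReal.ofReal r⁻¹ *
        ∫⁻ θ : sphere (0 : EuclideanSpace ℝ (Fin n)) 1,
          ‖Ω (r • (θ : EuclideanSpace ℝ (Fin n)) - y) - Ω θ‖ₑ
        ∂(volume : Measure (EuclideanSpace ℝ (Fin n))).toSphere := by
    rw [← inter_eq_left.2 (Ioi_subset_Ioi hR.le), ← setLIntegral_indicator measurableSet_Ioi]
    refine setLIntegral_congr_fun measurableSet_Ioi fun r (hr : 0 < r) => ?_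
    by_cases hrR : R < r
    · have h1 : ∀ θ : sphere (0 : EuclideanSpace ℝ (Fin n)) 1, {x | R < ‖x‖}.indicator
          (fun x => ‖Ω (x - y) - Ω x‖ₑ * ENNReal.ofReal ((‖x‖ ^ n)⁻¹))
          (r • (θ : EuclideanSpace ℝ (Fin n))) =
          ‖Ω (r • (θ : EuclideanSpace ℝ (Fin n)) - y) - Ω θ‖ₑ * ENNReal.ofReal ((r ^ n)⁻¹) := by
        intro θ
        have hθ : ‖(θ : EuclideanSpace ℝ (Fin n))‖ = 1 := by simp
        rw [indicator_of_mem (by simpa [norm_smul, abs_of_pos hr] using hrR), norm_smul, hθ,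
          hhom _ (by intro h; simp [h] at hθ) r hr, mul_one, Real.norm_of_nonneg hr.le]
      simp only [h1]
      rw [indicator_of_mem (by exact hrR), lintegral_mul_const _ (by fun_prop),
        ← ofReal_pow_mul_ofReal_inv_pow hn hr]
      ring
    · rw [indicator_of_notMem (by exact hrR)]
      have h1 : ∀ θ : sphere (0 : EuclideanSpace ℝ (Fin n)) 1, {x | R < ‖x‖}.indicator
          (fun x => ‖Ω (x - y) - Ω x‖ₑ * ENNReal.ofReal ((‖x‖ ^ n)⁻¹))
          (r • (θ : EuclideanSpace ℝ (Fin n))) = 0 := fun θ =>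
        indicator_of_notMem (by simpa [norm_smul, abs_of_pos hr] using hrR) _
      simp [h1]
  rw [hsub]
  have hM : 0 ≤ sphereL1Norm Ω := sphereL1Norm_nonneg
  have hbound : ∀ᵐ r ∂(volume.restrict (Ioi R)), ENNReal.ofReal r⁻¹ *
        ∫⁻ θ : sphere (0 : EuclideanSpace ℝ (Fin n)) 1,
          ‖Ω (r • (θ : EuclideanSpace ℝ (Fin n)) - y) - Ω θ‖ₑ
        ∂(volume : Measure (EuclideanSpace ℝ (Fin n))).toSphere ≤
      ENNReal.ofReal (A * n * ‖y‖ * sphereL1Norm Ω) * ENNReal.ofReal (r ^ (-2 : ℝ)) := by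
    filter_upwards [ae_lintegral_sphere_translate_lt_top hn hΩ hhom hint hyR',
      ae_restrict_mem measurableSet_Ioi] with r hr hrR
    have hrR : R < r := hrR
    have hr0 : 0 < r := hR.trans hrR
    have hδ : ∀ θ : sphere (0 : EuclideanSpace ℝ (Fin n)) 1,
        Ω (r • (θ : EuclideanSpace ℝ (Fin n)) - y) =
          Ω ((θ : EuclideanSpace ℝ (Fin n)) - (‖y‖ / r) • (‖y‖⁻¹ • y)) := fun θ => by
      have hθ : ‖(θ : EuclideanSpace ℝ (Fin n))‖ = 1 := by simp
      rw [← hhom ((θ : EuclideanSpace ℝ (Fin n)) - (‖y‖ / r) • (‖y‖⁻¹ • y)) _ r hr0]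
      · congr 1
        rw [smul_sub, smul_smul, smul_smul]
        congr 1
        rw [show r * (‖y‖ / r) * ‖y‖⁻¹ = 1 by field_simp, one_smul]
      · intro h
        rw [sub_eq_zero] at h
        rw [h, norm_smul, norm_smul, norm_inv, norm_norm, inv_mul_cancel₀ hy'.ne', mul_one,
          Real.norm_of_nonneg (by positivity), div_eq_one_iff_eq hr0.ne'] at hθ
        linarith
    have hI : Integrable (fun θ : sphere (0 : EuclideanSpace ℝ (Fin n)) 1 =>
        Ω (r • (θ : EuclideanSpace ℝ (Fin n)) - y) - Ω θ)
        (volume : Measure (EuclideanSpace ℝ (Fin n))).toSphere :=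
      Integrable.sub ⟨Measurable.aestronglyMeasurable (by fun_prop), hr⟩ hint
    have h6 := hsm (‖y‖⁻¹ • y) (by rw [norm_smul, norm_inv, norm_norm, inv_mul_cancel₀ hy'.ne'])
      (‖y‖ / r) (by positivity) (by
        rw [div_lt_div_iff₀ hr0 (by linarith)]
        nlinarith)
    simp only [← hδ] at h6
    rw [← ofReal_integral_norm_eq_lintegral_enorm hI, ← ENNReal.ofReal_mul (by positivity),
      ← ENNReal.ofReal_mul (by positivity)]
    refine ENNReal.ofReal_le_ofReal ?_
    calc _ ≤ r⁻¹ * (A * n * (‖y‖ / r) * sphereL1Norm Ω) :=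
          mul_le_mul_of_nonneg_left h6 (by positivity)
      _ = _ := by
          rw [Real.rpow_neg hr0.le]
          norm_num
          field_simp
  refine (lintegral_mono_ae hbound).trans ?_
  rw [lintegral_const_mul' _ _ ENNReal.ofReal_ne_top, lintegral_Ioi_inv_sq hR,
    ← ENNReal.ofReal_mul (by positivity), div_eq_mul_inv]

/-- The Hörmander condition for the kernel, with constants independent of the dimension. -/
theorem setLIntegral_homogeneousKernel_sub_le (hn : 1 ≤ n) (hΩ : Measurable Ω)
    (hhom : ∀ x : EuclideanSpace ℝ (Fin n), x ≠ 0 → ∀ δ : ℝ, 0 < δ → Ω (δ • x) = Ω x)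
    (hint : Integrable (fun θ : sphere (0 : EuclideanSpace ℝ (Fin n)) 1 => Ω θ)
        (volume : Measure (EuclideanSpace ℝ (Fin n))).toSphere)
    {A : ℝ} (hA : 1 ≤ A)
    (hsm : ∀ ξ : EuclideanSpace ℝ (Fin n), ‖ξ‖ = 1 → ∀ δ : ℝ, 0 < δ → δ < 1 / n →
        (∫ θ : sphere (0 : EuclideanSpace ℝ (Fin n)) 1,
            |Ω ((θ : EuclideanSpace ℝ (Fin n)) - δ • ξ) - Ω θ|
            ∂(volume : Measure (EuclideanSpace ℝ (Fin n))).toSphere) ≤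
          A * n * δ * sphereL1Norm Ω)
    {y : EuclideanSpace ℝ (Fin n)} {R : ℝ} (hR : 0 < R) (hyR : 2 * n * ‖y‖ ≤ R) :
    ∫⁻ x in {x | R < ‖x‖}, ‖homogeneousKernel Ω (x - y) - homogeneousKernel Ω x‖ₑ ≤
      ENNReal.ofReal (2 * A * sphereL1Norm Ω) := by
  have hM : 0 ≤ sphereL1Norm Ω := sphereL1Norm_nonneg
  have hm : MeasurableSet {x : EuclideanSpace ℝ (Fin n) | R < ‖x‖} :=
    measurable_norm (measurableSet_Ioi (a := R))
  have hK := measurable_homogeneousKernel hΩ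
  calc _ ≤ ∫⁻ x in {x | R < ‖x‖}, (ENNReal.ofReal 2 * (‖Ω (x - y) - Ω x‖ₑ * ENNReal.ofReal ((‖x‖ ^ n)⁻¹)) +
        ENNReal.ofReal (2 * n * ‖y‖) * (‖homogeneousKernel Ω x‖ₑ * ENNReal.ofReal ‖x‖⁻¹)) := by
        refine setLIntegral_mono (by fun_prop) fun x (hx : R < ‖x‖) => ?_
        have h := abs_homogeneousKernel_sub_le (Ω := Ω) hn (norm_pos_iff.1 (hR.trans hx))
          (hyR.trans hx.le)
        rw [Real.enorm_eq_ofReal_abs (_ - homogeneousKernel Ω x)]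
        refine (ENNReal.ofReal_le_ofReal h).trans_eq ?_
        rw [ENNReal.ofReal_add (by positivity)
          (by positivity), ENNReal.ofReal_mul (by positivity), ENNReal.ofReal_mul (by positivity),
          ENNReal.ofReal_mul (p := 2 * n * ‖y‖) (by positivity),
          ENNReal.ofReal_mul (p := |homogeneousKernel Ω x|) (by positivity),
          ← Real.enorm_eq_ofReal_abs, ← Real.enorm_eq_ofReal_abs]
    _ = ENNReal.ofReal 2 * (∫⁻ x in {x | R < ‖x‖}, ‖Ω (x - y) - Ω x‖ₑ * ENNReal.ofReal ((‖x‖ ^ n)⁻¹)) +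
        ENNReal.ofReal (2 * n * ‖y‖) *
          ∫⁻ x in {x | R < ‖x‖}, ‖homogeneousKernel Ω x‖ₑ * ENNReal.ofReal ‖x‖⁻¹ := by
        rw [lintegral_add_left (by fun_prop), lintegral_const_mul _ (by fun_prop),
          lintegral_const_mul _ (by fun_prop)]
    _ ≤ ENNReal.ofReal 2 * ENNReal.ofReal (A * n * ‖y‖ * sphereL1Norm Ω / R) +
        ENNReal.ofReal (2 * n * ‖y‖) * ENNReal.ofReal (sphereL1Norm Ω / R) := by
        rw [setLIntegral_homogeneousKernel_mul_inv_norm hn hΩ hhom hint hR]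
        gcongr
        exact setLIntegral_angular_sub_le hn hΩ hhom hint (by linarith) hsm hR hyR
    _ ≤ _ := by
        rw [← ENNReal.ofReal_mul (by positivity),
          ← ENNReal.ofReal_mul (by positivity), ← ENNReal.ofReal_add (by positivity)
          (by positivity)]
        refine ENNReal.ofReal_le_ofReal ?_
        have h7 : 2 * n * ‖y‖ / R ≤ 1 := (div_le_one hR).2 hyR
        have h8 : 0 ≤ 2 * n * ‖y‖ / R := by positivity
        have h9 : A * sphereL1Norm Ω * (2 * n * ‖y‖ / R) ≤ A * sphereL1Norm Ω :=
          mul_le_of_le_one_right (by positivity) h7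
        have h10 : sphereL1Norm Ω * (2 * n * ‖y‖ / R) ≤ sphereL1Norm Ω :=
          mul_le_of_le_one_right hM h7
        have h11 : sphereL1Norm Ω ≤ A * sphereL1Norm Ω := le_mul_of_one_le_left hM hA
        calc _ = A * sphereL1Norm Ω * (2 * n * ‖y‖ / R) +
              sphereL1Norm Ω * (2 * n * ‖y‖ / R) := by ring
          _ ≤ _ := by linarith

end Hormander

section SineIntegral

theorem abs_integral_sin_div_le_of_one_le {a b : ℝ} (ha : 1 ≤ a) (hab : a ≤ b) :
    |∫ x in a..b, Real.sin x / x| ≤ 3 := by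
  have hpos : ∀ x ∈ uIcc a b, 0 < x := fun x hx => by
    rw [uIcc_of_le hab] at hx
    linarith [hx.1]
  have hc2 : ContinuousOn (fun x : ℝ => -(x ^ 2)⁻¹) (uIcc a b) :=
    ((continuousOn_pow 2).inv₀ fun x hx => (pow_pos (hpos x hx) 2).ne').neg
  have hparts := intervalIntegral.integral_mul_deriv_eq_deriv_mul (a := a) (b := b)
    (u := fun x : ℝ => x⁻¹) (u' := fun x : ℝ => -(x ^ 2)⁻¹)
    (v := fun x => -Real.cos x) (v' := Real.sin)
    (fun x hx => hasDerivAt_inv (hpos x hx).ne')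
    (fun x _ => by
      have := (Real.hasDerivAt_cos x).fun_neg
      rw [neg_neg] at this
      exact this)
    hc2.intervalIntegrable (Real.continuous_sin.intervalIntegrable _ _)
  have e1 : ∫ x in a..b, Real.sin x / x = ∫ x in a..b, x⁻¹ * Real.sin x :=
    intervalIntegral.integral_congr fun x _ => by simp [div_eq_mul_inv, mul_comm]
  rw [e1, hparts]
  have hb : ‖∫ x in a..b, -(x ^ 2)⁻¹ * -Real.cos x‖ ≤ ∫ x in a..b, (x ^ 2)⁻¹ := by
    refine intervalIntegral.norm_integral_le_of_norm_le hab (.of_forall fun x _ => ?_) ?_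
    · rw [Real.norm_eq_abs, abs_mul, abs_neg, abs_neg, abs_of_nonneg (by positivity)]
      exact mul_le_of_le_one_right (by positivity) (Real.abs_cos_le_one x)
    · exact ((continuousOn_pow 2).inv₀ fun x hx => (pow_pos (hpos x hx) 2).ne').intervalIntegrable
  have hi : ∫ x in a..b, (x ^ 2)⁻¹ = a⁻¹ - b⁻¹ := by
    have := intervalIntegral.integral_eq_sub_of_hasDerivAt (a := a) (b := b)
      (f := fun x : ℝ => x⁻¹) (f' := fun x : ℝ => -(x ^ 2)⁻¹)
      (fun x hx => hasDerivAt_inv (hpos x hx).ne') hc2.intervalIntegrable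
    rw [intervalIntegral.integral_neg] at this
    linarith
  rw [hi, Real.norm_eq_abs] at hb
  have ha1 : a⁻¹ ≤ 1 := inv_le_one_of_one_le₀ ha
  have hb0 : 0 < b⁻¹ := inv_pos.2 (by linarith)
  have ha0 : 0 < a⁻¹ := inv_pos.2 (by linarith)
  have hba : b⁻¹ ≤ a⁻¹ := inv_anti₀ (by linarith) hab
  have h1 : |b⁻¹ * -Real.cos b| ≤ b⁻¹ := by
    rw [abs_mul, abs_neg, abs_of_pos hb0]
    exact mul_le_of_le_one_right hb0.le (Real.abs_cos_le_one b)
  have h2 : |a⁻¹ * -Real.cos a| ≤ a⁻¹ := by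
    rw [abs_mul, abs_neg, abs_of_pos ha0]
    exact mul_le_of_le_one_right ha0.le (Real.abs_cos_le_one a)
  rw [abs_le] at *
  constructor <;> linarith [h1.1, h1.2, h2.1, h2.2, hb.1, hb.2]

theorem abs_integral_sin_div_le_of_le_one {a b : ℝ} (ha : 0 < a) (hab : a ≤ b) (hb : b ≤ 1) :
    |∫ x in a..b, Real.sin x / x| ≤ 1 := by
  have := intervalIntegral.norm_integral_le_of_norm_le_const (a := a) (b := b) (C := 1)
    (f := fun x => Real.sin x / x) fun x hx => by
      rw [uIoc_of_le hab] at hx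
      have hx0 : 0 < x := ha.trans hx.1
      rw [Real.norm_eq_abs, abs_div, abs_of_pos hx0, div_le_one hx0]
      simpa [abs_of_pos hx0] using Real.abs_sin_le_abs (x := x)
  rw [Real.norm_eq_abs, abs_of_nonneg (by linarith : 0 ≤ b - a)] at this
  linarith

theorem abs_integral_sin_div_le {a b : ℝ} (ha : 0 < a) (hab : a ≤ b) :
    |∫ x in a..b, Real.sin x / x| ≤ 4 := by
  rcases le_total b 1 with hb | hb
  · linarith [abs_integral_sin_div_le_of_le_one ha hab hb]
  rcases le_total 1 a with ha1 | ha1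
  · linarith [abs_integral_sin_div_le_of_one_le ha1 hab]
  have hi : ∀ c d : ℝ, 0 < c → c ≤ d →
      IntervalIntegrable (fun x => Real.sin x / x) volume c d := fun c d hc hcd =>
    (Real.continuous_sin.continuousOn.div continuousOn_id fun x hx => by
      rw [uIcc_of_le hcd] at hx
      exact (hc.trans_le hx.1).ne').intervalIntegrable
  rw [← intervalIntegral.integral_add_adjacent_intervals (hi a 1 ha ha1) (hi 1 b one_pos hb)]
  linarith [abs_add_le (∫ x in a..1, Real.sin x / x) (∫ x in 1..b, Real.sin x / x),
    abs_integral_sin_div_le_of_le_one ha ha1 le_rfl, abs_integral_sin_div_le_of_one_le le_rfl hb]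

theorem abs_integral_sin_mul_div_le_of_pos {w a b : ℝ} (hw : 0 < w) (ha : 0 < a) (hab : a ≤ b) :
    |∫ r in a..b, Real.sin (w * r) / r| ≤ 4 := by
  have h := intervalIntegral.integral_comp_mul_left (a := a) (b := b)
    (fun x => Real.sin x / x) hw.ne'
  have e : ∫ r in a..b, Real.sin (w * r) / r =
      w * ∫ r in a..b, Real.sin (w * r) / (w * r) := by
    rw [← intervalIntegral.integral_const_mul]
    refine intervalIntegral.integral_congr fun r hr => ?_
    rw [uIcc_of_le hab] at hr
    have : 0 < r := ha.trans_le hr.1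
    field_simp
  rw [e, h, smul_eq_mul, mul_inv_cancel_left₀ hw.ne']
  exact abs_integral_sin_div_le (by positivity) (by gcongr)

/-- The truncated Hilbert kernel has a uniformly bounded sine transform. -/
theorem abs_integral_sin_mul_div_le (w : ℝ) {a b : ℝ} (ha : 0 < a) (hab : a ≤ b) :
    |∫ r in a..b, Real.sin (w * r) / r| ≤ 4 := by
  rcases lt_trichotomy w 0 with hw | rfl | hw
  · have := abs_integral_sin_mul_div_le_of_pos (neg_pos.2 hw) ha hab
    simpa [neg_div, intervalIntegral.integral_neg] using this
  · simp
  · exact abs_integral_sin_mul_div_le_of_pos hw ha hab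

end SineIntegral

/-- The kernel `Ω(x) / |x| ^ n` truncated to the shell `ε ≤ |x| < R`. -/
noncomputable def truncatedKernel {n : ℕ} (Ω : EuclideanSpace ℝ (Fin n) → ℝ) (ε R : ℝ) :
    EuclideanSpace ℝ (Fin n) → ℝ :=
  {x | ε ≤ ‖x‖ ∧ ‖x‖ < R}.indicator (homogeneousKernel Ω)

section Truncated

open scoped ENNReal FourierTransform

variable {n : ℕ} {Ω : EuclideanSpace ℝ (Fin n) → ℝ}

theorem measurableSet_shell (ε R : ℝ) :
    MeasurableSet {x : EuclideanSpace ℝ (Fin n) | ε ≤ ‖x‖ ∧ ‖x‖ < R} :=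
  measurable_norm (measurableSet_Ico (a := ε) (b := R))

theorem measurable_truncatedKernel (hΩ : Measurable Ω) (ε R : ℝ) :
    Measurable (truncatedKernel Ω ε R) :=
  (measurable_homogeneousKernel hΩ).indicator (measurableSet_shell ε R)

theorem lintegral_truncatedKernel_le (hn : 1 ≤ n) (hΩ : Measurable Ω)
    (hhom : ∀ x : EuclideanSpace ℝ (Fin n), x ≠ 0 → ∀ δ : ℝ, 0 < δ → Ω (δ • x) = Ω x)
    (hint : Integrable (fun θ : sphere (0 : EuclideanSpace ℝ (Fin n)) 1 => Ω θ)
        (volume : Measure (EuclideanSpace ℝ (Fin n))).toSphere)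
    {ε R : ℝ} (hε : 0 < ε) (hεR : ε ≤ R) :
    ∫⁻ x, ‖truncatedKernel Ω ε R x‖ₑ ≤ ENNReal.ofReal (sphereL1Norm Ω * Real.log (R / ε)) := by
  rw [← setLIntegral_homogeneousKernel_annulus hn hΩ hhom hint hε hεR]
  simp only [truncatedKernel, enorm_indicator_eq_indicator_enorm]
  rw [lintegral_indicator (measurableSet_shell ε R)]
  exact lintegral_mono_set fun x hx => ⟨hx.1, hx.2.le⟩

theorem integrable_truncatedKernel (hn : 1 ≤ n) (hΩ : Measurable Ω)
    (hhom : ∀ x : EuclideanSpace ℝ (Fin n), x ≠ 0 → ∀ δ : ℝ, 0 < δ → Ω (δ • x) = Ω x)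
    (hint : Integrable (fun θ : sphere (0 : EuclideanSpace ℝ (Fin n)) 1 => Ω θ)
        (volume : Measure (EuclideanSpace ℝ (Fin n))).toSphere)
    {ε R : ℝ} (hε : 0 < ε) (hεR : ε ≤ R) :
    Integrable (truncatedKernel Ω ε R) :=
  ⟨(measurable_truncatedKernel hΩ ε R).aestronglyMeasurable,
    (lintegral_truncatedKernel_le hn hΩ hhom hint hε hεR).trans_lt ENNReal.ofReal_lt_top⟩

theorem truncatedKernel_neg
    (hodd : ∀ x : EuclideanSpace ℝ (Fin n), x ≠ 0 → Ω (-x) = -Ω x)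
    {ε R : ℝ} (hε : 0 < ε) (x : EuclideanSpace ℝ (Fin n)) :
    truncatedKernel Ω ε R (-x) = -truncatedKernel Ω ε R x := by
  by_cases hx : ε ≤ ‖x‖ ∧ ‖x‖ < R
  · have hx0 : x ≠ 0 := norm_pos_iff.1 (hε.trans_le hx.1)
    simp [truncatedKernel, indicator, hx, homogeneousKernel_neg hodd hx0]
  · simp [truncatedKernel, indicator, hx]

/-- The sine transform of the truncated kernel is bounded, by integrating in polar coordinates. -/
theorem abs_integral_sin_mul_truncatedKernel_le (hn : 1 ≤ n) (hΩ : Measurable Ω)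
    (hhom : ∀ x : EuclideanSpace ℝ (Fin n), x ≠ 0 → ∀ δ : ℝ, 0 < δ → Ω (δ • x) = Ω x)
    (hint : Integrable (fun θ : sphere (0 : EuclideanSpace ℝ (Fin n)) 1 => Ω θ)
        (volume : Measure (EuclideanSpace ℝ (Fin n))).toSphere)
    {ε R : ℝ} (hε : 0 < ε) (hεR : ε ≤ R) (ξ : EuclideanSpace ℝ (Fin n)) :
    |∫ x, Real.sin (2 * Real.pi * inner ℝ x ξ) * truncatedKernel Ω ε R x| ≤
      4 * sphereL1Norm Ω := by
  have hk := integrable_truncatedKernel hn hΩ hhom hint hε hεR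
  have hsk : Integrable fun x =>
      Real.sin (2 * Real.pi * inner ℝ x ξ) * truncatedKernel Ω ε R x :=
    hk.bdd_mul (c := 1) (by fun_prop) (.of_forall fun x => Real.abs_sin_le_one _)
  rw [integral_polar hn hsk, sphereL1Norm, ← integral_const_mul, ← Real.norm_eq_abs]
  refine norm_integral_le_of_norm_le (hint.abs.const_mul 4) (.of_forall fun θ => ?_)
  have hθ : ‖(θ : EuclideanSpace ℝ (Fin n))‖ = 1 := by simp
  have e : ∫ r in Ioi (0 : ℝ), r ^ (n - 1) *
      (Real.sin (2 * Real.pi * inner ℝ (r • (θ : EuclideanSpace ℝ (Fin n))) ξ) *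
        truncatedKernel Ω ε R (r • (θ : EuclideanSpace ℝ (Fin n)))) =
      Ω θ * ∫ r in ε..R, Real.sin (2 * Real.pi *
        inner ℝ (θ : EuclideanSpace ℝ (Fin n)) ξ * r) / r := by
    rw [← intervalIntegral.integral_const_mul, intervalIntegral.integral_of_le hεR,
      ← integral_Ico_eq_integral_Ioc,
      ← inter_eq_right.2 (show Ico ε R ⊆ Ioi 0 from fun r hr => hε.trans_le hr.1),
      ← setIntegral_indicator measurableSet_Ico]
    refine setIntegral_congr_fun measurableSet_Ioi fun r (hr : 0 < r) => ?_
    have hnr : ‖r • (θ : EuclideanSpace ℝ (Fin n))‖ = r := by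
      rw [norm_smul, hθ, mul_one, Real.norm_of_nonneg hr.le]
    by_cases hrI : ε ≤ r ∧ r < R
    · have h1 : truncatedKernel Ω ε R (r • (θ : EuclideanSpace ℝ (Fin n))) = Ω θ / r ^ n := by
        rw [truncatedKernel, indicator_of_mem (by simpa only [mem_ofPred_eq, hnr] using hrI),
          homogeneousKernel_smul_sphere hhom hr]
      simp only [h1]
      rw [indicator_of_mem (by exact hrI), inner_smul_left]
      obtain ⟨m, rfl⟩ : ∃ m, n = m + 1 := ⟨n - 1, by omega⟩
      rw [Nat.add_sub_cancel, pow_succ]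
      simp only [conj_trivial]
      rw [show 2 * Real.pi * (r * inner ℝ (θ : EuclideanSpace ℝ (Fin (m + 1))) ξ) =
        2 * Real.pi * inner ℝ (θ : EuclideanSpace ℝ (Fin (m + 1))) ξ * r by ring]
      field_simp
    · have h1 : truncatedKernel Ω ε R (r • (θ : EuclideanSpace ℝ (Fin n))) = 0 := by
        rw [truncatedKernel, indicator_of_notMem (by simpa only [mem_ofPred_eq, hnr] using hrI)]
      simp only [h1]
      rw [indicator_of_notMem (by exact hrI)]
      simp
  rw [e, norm_mul, mul_comm]
  exact mul_le_mul_of_nonneg_right (abs_integral_sin_mul_div_le _ hε hεR) (norm_nonneg _)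

theorem norm_fourier_truncatedKernel_le (hn : 1 ≤ n) (hΩ : Measurable Ω)
    (hodd : ∀ x : EuclideanSpace ℝ (Fin n), x ≠ 0 → Ω (-x) = -Ω x)
    (hhom : ∀ x : EuclideanSpace ℝ (Fin n), x ≠ 0 → ∀ δ : ℝ, 0 < δ → Ω (δ • x) = Ω x)
    (hint : Integrable (fun θ : sphere (0 : EuclideanSpace ℝ (Fin n)) 1 => Ω θ)
        (volume : Measure (EuclideanSpace ℝ (Fin n))).toSphere)
    {ε R : ℝ} (hε : 0 < ε) (hεR : ε ≤ R) (ξ : EuclideanSpace ℝ (Fin n)) :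
    ‖𝓕 (fun x => (truncatedKernel Ω ε R x : ℂ)) ξ‖ ≤ 4 * sphereL1Norm Ω := by
  have hk := integrable_truncatedKernel hn hΩ hhom hint hε hεR
  set f : EuclideanSpace ℝ (Fin n) → ℂ := fun x =>
    Real.fourierChar (-inner ℝ x ξ) • (truncatedKernel Ω ε R x : ℂ) with hf
  have hfi : Integrable f := (Real.fourierIntegral_convergent_iff ξ).2 hk.ofReal
  have h2 : (2 : ℂ) * ∫ x, f x = ∫ x, (f x + f (-x)) := by
    rw [integral_add hfi hfi.comp_neg, integral_neg_eq_self f, two_mul]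
  have h3 : ∀ x, f x + f (-x) = (-2 * Complex.I) *
      ((Real.sin (2 * Real.pi * inner ℝ x ξ) * truncatedKernel Ω ε R x : ℝ) : ℂ) := by
    intro x
    simp only [hf, truncatedKernel_neg hodd hε, inner_neg_left, neg_neg, Circle.smul_def,
      Real.fourierChar_apply, smul_eq_mul]
    push_cast
    rw [Complex.sin]
    have hI : Complex.I * Complex.I = -1 := Complex.I_mul_I
    ring_nf
    rw [Complex.I_sq]
    ring_nf
  simp only [h3] at h2
  rw [integral_const_mul, integral_complex_ofReal] at h2
  have h4 : ∫ x, f x = -Complex.I *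
      ((∫ x, Real.sin (2 * Real.pi * inner ℝ x ξ) * truncatedKernel Ω ε R x : ℝ) : ℂ) := by
    refine mul_left_cancel₀ (two_ne_zero (α := ℂ)) ?_
    rw [h2]
    ring
  rw [Real.fourier_eq]
  change ‖∫ x, f x‖ ≤ _
  rw [h4, norm_mul, norm_neg, Complex.norm_I, one_mul, Complex.norm_real, Real.norm_eq_abs]
  exact abs_integral_sin_mul_truncatedKernel_le hn hΩ hhom hint hε hεR ξ

open scoped Convolution in
/-- Dimension-free `L²` bound for the truncated singular integral. -/
theorem lintegral_sq_truncated_convolution_le (hn : 1 ≤ n) (hΩ : Measurable Ω)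
    (hodd : ∀ x : EuclideanSpace ℝ (Fin n), x ≠ 0 → Ω (-x) = -Ω x)
    (hhom : ∀ x : EuclideanSpace ℝ (Fin n), x ≠ 0 → ∀ δ : ℝ, 0 < δ → Ω (δ • x) = Ω x)
    (hint : Integrable (fun θ : sphere (0 : EuclideanSpace ℝ (Fin n)) 1 => Ω θ)
        (volume : Measure (EuclideanSpace ℝ (Fin n))).toSphere)
    {ε R : ℝ} (hε : 0 < ε) (hεR : ε ≤ R) {f : EuclideanSpace ℝ (Fin n) → ℝ}
    (hf : Integrable f) {C : ℝ} (hC : ∀ x, |f x| ≤ C) :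
    ∫⁻ x, ‖∫ u, truncatedKernel Ω ε R u * f (x - u)‖ₑ ^ 2 ≤
      ENNReal.ofReal (4 * sphereL1Norm Ω) ^ 2 * ∫⁻ x, ‖f x‖ₑ ^ 2 := by
  have hk := integrable_truncatedKernel hn hΩ hhom hint hε hεR
  have sq_of_bdd : ∀ {g : EuclideanSpace ℝ (Fin n) → ℂ} (D : ℝ), Integrable g →
      (∀ x, ‖g x‖ ≤ D) → MemLp g 2 := fun {g} D hg hD => by
    rw [← memLp_norm_iff hg.aestronglyMeasurable,
      memLp_two_iff_integrable_sq hg.norm.aestronglyMeasurable]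
    refine (hg.norm.const_mul D).mono' (hg.norm.aestronglyMeasurable.pow 2)
      (.of_forall fun x => ?_)
    rw [norm_pow, norm_norm, sq]
    exact mul_le_mul_of_nonneg_right (hD x) (norm_nonneg _)
  have hkC : Integrable fun x => (truncatedKernel Ω ε R x : ℂ) := hk.ofReal
  have hfC : Integrable fun x => (f x : ℂ) := hf.ofReal
  have e : ∀ x, ((fun x => (truncatedKernel Ω ε R x : ℂ))
      ⋆[ContinuousLinearMap.mul ℂ ℂ] fun x => (f x : ℂ)) x =
      ((∫ u, truncatedKernel Ω ε R u * f (x - u) : ℝ) : ℂ) := fun x => by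
    rw [convolution, ← integral_complex_ofReal]
    simp
  have hconv : Integrable ((fun x => (truncatedKernel Ω ε R x : ℂ))
      ⋆[ContinuousLinearMap.mul ℂ ℂ] fun x => (f x : ℂ)) :=
    Integrable.integrable_convolution _ hkC hfC
  have h := eLpNorm_convolution_le_of_fourier_le hkC
    (norm_fourier_truncatedKernel_le hn hΩ hodd hhom hint hε hεR) hfC
    (sq_of_bdd C hfC fun x => by simpa using hC x)
    (sq_of_bdd (∫ u, |truncatedKernel Ω ε R u| * C) hconv fun x => by
      rw [e, Complex.norm_real]
      refine norm_integral_le_of_norm_le (hk.abs.mul_const C) (.of_forall fun u => ?_)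
      rw [norm_mul]
      exact mul_le_mul_of_nonneg_left (hC _) (norm_nonneg _))
  have hsq : ∀ g : EuclideanSpace ℝ (Fin n) → ℂ, eLpNorm g 2 ^ 2 = ∫⁻ x, ‖g x‖ₑ ^ 2 := fun g => by
    have := eLpNorm_nnreal_pow_eq_lintegral (f := g) (μ := volume) (p := 2) two_ne_zero
    simpa [ENNReal.rpow_ofNat] using this
  have h' := pow_le_pow_left' h 2
  rw [mul_pow, hsq, hsq] at h'
  simp only [e] at h'
  have henorm : ∀ t : ℝ, ‖(t : ℂ)‖ₑ = ‖t‖ₑ := fun t => by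
    rw [← ofReal_norm, Complex.norm_real, ofReal_norm]
  simpa only [henorm] using h'

end Truncated

/-- The half-open axis-parallel cube with lower corner `z` and side `ℓ`. -/
def box {n : ℕ} (z : EuclideanSpace ℝ (Fin n)) (ℓ : ℝ) : Set (EuclideanSpace ℝ (Fin n)) :=
  {y | ∀ i, z i ≤ y i ∧ y i < z i + ℓ}

/-- The normalized indicator function of a cube. -/
noncomputable def boxAverage {n : ℕ} (z : EuclideanSpace ℝ (Fin n)) (ℓ : ℝ) :
    EuclideanSpace ℝ (Fin n) → ℝ :=
  (box z ℓ).indicator fun _ => (ℓ ^ n)⁻¹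

section Box

open scoped ENNReal

variable {n : ℕ}

theorem box_eq_preimage (z : EuclideanSpace ℝ (Fin n)) (ℓ : ℝ) :
    box z ℓ = (MeasurableEquiv.toLp 2 (Fin n → ℝ)).symm ⁻¹'
      (univ.pi fun i => Ico (z i) (z i + ℓ)) := by
  ext y
  simp [box]

theorem measurableSet_box (z : EuclideanSpace ℝ (Fin n)) (ℓ : ℝ) : MeasurableSet (box z ℓ) := by
  rw [box_eq_preimage]
  exact MeasurableEquiv.measurable _ (MeasurableSet.univ_pi fun _ => measurableSet_Ico)

theorem volume_box (z : EuclideanSpace ℝ (Fin n)) {ℓ : ℝ} (hℓ : 0 ≤ ℓ) :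
    volume (box z ℓ) = ENNReal.ofReal (ℓ ^ n) := by
  rw [box_eq_preimage, (EuclideanSpace.volume_preserving_symm_measurableEquiv_toLp
    (Fin n)).measure_preimage_equiv, Real.volume_pi_Ico]
  simp [ENNReal.ofReal_pow hℓ]

theorem norm_le_of_forall_abs_le {x : EuclideanSpace ℝ (Fin n)} {r : ℝ} (hr : 0 ≤ r)
    (h : ∀ i, |x i| ≤ r) : ‖x‖ ≤ n * r := by
  rw [EuclideanSpace.norm_eq]
  refine Real.sqrt_le_iff.2 ⟨by positivity, ?_⟩
  calc ∑ i, ‖x i‖ ^ 2 ≤ ∑ _i : Fin n, r ^ 2 :=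
        Finset.sum_le_sum fun i _ => pow_le_pow_left₀ (norm_nonneg _) (h i) 2
    _ = n * r ^ 2 := by simp
    _ ≤ (n * r) ^ 2 := by
        rw [mul_pow]
        gcongr
        exact_mod_cast Nat.le_self_pow two_ne_zero n

theorem norm_sub_le_of_mem_box {z x y : EuclideanSpace ℝ (Fin n)} {ℓ : ℝ} (hℓ : 0 ≤ ℓ)
    (hx : x ∈ box z ℓ) (hy : y ∈ box z ℓ) : ‖x - y‖ ≤ n * ℓ :=
  norm_le_of_forall_abs_le hℓ fun i => by
    rw [PiLp.sub_apply, abs_le]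
    constructor <;> linarith [(hx i).1, (hx i).2, (hy i).1, (hy i).2]

theorem measurable_boxAverage (z : EuclideanSpace ℝ (Fin n)) (ℓ : ℝ) :
    Measurable (boxAverage z ℓ) :=
  measurable_const.indicator (measurableSet_box z ℓ)

theorem boxAverage_nonneg (z : EuclideanSpace ℝ (Fin n)) {ℓ : ℝ} (hℓ : 0 ≤ ℓ)
    (x : EuclideanSpace ℝ (Fin n)) : 0 ≤ boxAverage z ℓ x :=
  indicator_nonneg (fun _ _ => by positivity) x

theorem abs_boxAverage_le (z : EuclideanSpace ℝ (Fin n)) {ℓ : ℝ} (hℓ : 0 ≤ ℓ)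
    (x : EuclideanSpace ℝ (Fin n)) : |boxAverage z ℓ x| ≤ (ℓ ^ n)⁻¹ := by
  rw [abs_of_nonneg (boxAverage_nonneg z hℓ x)]
  exact indicator_le_self' (fun _ _ => by positivity) x

theorem lintegral_enorm_boxAverage (z : EuclideanSpace ℝ (Fin n)) {ℓ : ℝ} (hℓ : 0 < ℓ) :
    ∫⁻ x, ‖boxAverage z ℓ x‖ₑ = 1 := by
  simp only [boxAverage, enorm_indicator_eq_indicator_enorm]
  rw [lintegral_indicator_const (measurableSet_box z ℓ), volume_box z hℓ.le,
    Real.enorm_of_nonneg (by positivity), ← ENNReal.ofReal_mul (by positivity),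
    inv_mul_cancel₀ (by positivity), ENNReal.ofReal_one]

theorem integrable_boxAverage (z : EuclideanSpace ℝ (Fin n)) {ℓ : ℝ} (hℓ : 0 < ℓ) :
    Integrable (boxAverage z ℓ) :=
  ⟨(measurable_boxAverage z ℓ).aestronglyMeasurable, by
    rw [HasFiniteIntegral, lintegral_enorm_boxAverage z hℓ]
    exact ENNReal.one_lt_top⟩

theorem integral_boxAverage (z : EuclideanSpace ℝ (Fin n)) {ℓ : ℝ} (hℓ : 0 < ℓ) :
    ∫ x, boxAverage z ℓ x = 1 := by
  rw [integral_eq_lintegral_of_nonneg_ae (.of_forall (boxAverage_nonneg z hℓ.le))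
    (measurable_boxAverage z ℓ).aestronglyMeasurable]
  simp only [← Real.enorm_of_nonneg (boxAverage_nonneg z hℓ.le _)]
  rw [lintegral_enorm_boxAverage z hℓ, ENNReal.toReal_one]

theorem preimage_sub_box (z u : EuclideanSpace ℝ (Fin n)) (ℓ : ℝ) :
    (fun x => x - u) ⁻¹' box z ℓ = box (z + u) ℓ := by
  ext x
  simp only [box, mem_preimage, mem_ofPred_eq, PiLp.sub_apply, PiLp.add_apply]
  refine forall_congr' fun i => and_congr ?_ ?_ <;> constructor <;> intro h <;> linarith

/-- Translating a normalized cube by `u` changes it in `L¹` by at most `4n‖u‖/ℓ`. -/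
theorem lintegral_boxAverage_sub_le (z u : EuclideanSpace ℝ (Fin n)) {ℓ : ℝ} (hℓ : 0 < ℓ)
    (hu : 2 * ‖u‖ ≤ ℓ) :
    ∫⁻ x, ‖boxAverage z ℓ (x - u) - boxAverage z ℓ x‖ₑ ≤ ENNReal.ofReal (4 * n * ‖u‖ / ℓ) := by
  set w : EuclideanSpace ℝ (Fin n) := WithLp.toLp 2 fun i => z i + ‖u‖ with hw
  set B := box w (ℓ - 2 * ‖u‖) with hB
  have hui : ∀ i, |u i| ≤ ‖u‖ := fun i => PiLp.norm_apply_le u i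
  have hBz : B ⊆ box z ℓ := fun y hy i => by
    have := hy i
    simp only [hw] at this
    constructor <;> linarith [norm_nonneg u]
  have hBu : B ⊆ box (z + u) ℓ := fun y hy i => by
    have := hy i
    simp only [hw] at this
    have h2 := abs_le.1 (hui i)
    rw [PiLp.add_apply]
    constructor <;> linarith
  have hmB : MeasurableSet B := measurableSet_box _ _
  have hvB : volume B = ENNReal.ofReal ((ℓ - 2 * ‖u‖) ^ n) := volume_box _ (by linarith)
  have hdiff : ∀ v, B ⊆ box v ℓ →
      ENNReal.ofReal ((ℓ ^ n)⁻¹) * volume (box v ℓ \ B) ≤ ENNReal.ofReal (2 * n * ‖u‖ / ℓ) := by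
    intro v hv
    rw [measure_sdiff hv hmB.nullMeasurableSet (by simp [hvB]), volume_box _ hℓ.le, hvB,
      ← ENNReal.ofReal_sub _ (pow_nonneg (by linarith) _), ← ENNReal.ofReal_mul (by positivity)]
    refine ENNReal.ofReal_le_ofReal ?_
    have hb := one_add_mul_le_pow (a := -(2 * ‖u‖ / ℓ))
      (by linarith [(div_le_one hℓ).2 hu]) n
    have he : (ℓ - 2 * ‖u‖) ^ n = ℓ ^ n * (1 + -(2 * ‖u‖ / ℓ)) ^ n := by
      rw [← mul_pow]
      congr 1
      field_simp
      ring
    rw [he, mul_sub, inv_mul_cancel₀ (by positivity), inv_mul_cancel_left₀ (by positivity)]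
    have : 2 * n * ‖u‖ / ℓ = n * (2 * ‖u‖ / ℓ) := by ring
    linarith
  have hpt : ∀ x, ‖boxAverage z ℓ (x - u) - boxAverage z ℓ x‖ₑ ≤
      (box (z + u) ℓ \ B).indicator (fun _ => ENNReal.ofReal ((ℓ ^ n)⁻¹)) x +
        (box z ℓ \ B).indicator (fun _ => ENNReal.ofReal ((ℓ ^ n)⁻¹)) x := by
    intro x
    have h1 : boxAverage z ℓ (x - u) = (box (z + u) ℓ).indicator (fun _ => (ℓ ^ n)⁻¹) x := by
      rw [← preimage_sub_box]
      rfl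
    have hc : ‖(ℓ ^ n)⁻¹‖ₑ = ENNReal.ofReal ((ℓ ^ n)⁻¹) := Real.enorm_of_nonneg (by positivity)
    rw [h1, boxAverage]
    by_cases hxB : x ∈ B
    · simp [hBz hxB, hBu hxB]
    · by_cases hx1 : x ∈ box (z + u) ℓ <;> by_cases hx2 : x ∈ box z ℓ <;>
        simp [hxB, hx1, hx2, hc, -enorm_inv]
  calc _ ≤ _ := lintegral_mono hpt
    _ = ENNReal.ofReal ((ℓ ^ n)⁻¹) * volume (box (z + u) ℓ \ B) +
        ENNReal.ofReal ((ℓ ^ n)⁻¹) * volume (box z ℓ \ B) := by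
      rw [lintegral_add_left (measurable_const.indicator ((measurableSet_box _ _).diff hmB)),
        lintegral_indicator_const ((measurableSet_box _ _).diff hmB),
        lintegral_indicator_const ((measurableSet_box _ _).diff hmB)]
    _ ≤ ENNReal.ofReal (2 * n * ‖u‖ / ℓ) + ENNReal.ofReal (2 * n * ‖u‖ / ℓ) :=
      add_le_add (hdiff _ hBu) (hdiff _ hBz)
    _ = _ := by
      rw [← ENNReal.ofReal_add (by positivity) (by positivity)]
      congr 1
      ring

end Box

section SingleDirac

open scoped ENNReal

variable {n : ℕ} {Ω : EuclideanSpace ℝ (Fin n) → ℝ}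

theorem enorm_integral_mul_le_lintegral {α : Type*} [MeasurableSpace α] {μ : Measure α}
    (f g : α → ℝ) : ‖∫ x, f x * g x ∂μ‖ₑ ≤ ∫⁻ x, ‖f x‖ₑ * ‖g x‖ₑ ∂μ := by
  simpa only [enorm_mul] using enorm_integral_le_lintegral_enorm (μ := μ) fun x => f x * g x

theorem integrable_truncatedKernel_mul_boxAverage (hn : 1 ≤ n) (hΩ : Measurable Ω)
    (hhom : ∀ x : EuclideanSpace ℝ (Fin n), x ≠ 0 → ∀ δ : ℝ, 0 < δ → Ω (δ • x) = Ω x)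
    (hint : Integrable (fun θ : sphere (0 : EuclideanSpace ℝ (Fin n)) 1 => Ω θ)
        (volume : Measure (EuclideanSpace ℝ (Fin n))).toSphere)
    {ε R ℓ : ℝ} (hε : 0 < ε) (hεR : ε ≤ R) (hℓ : 0 ≤ ℓ) (z x : EuclideanSpace ℝ (Fin n)) :
    Integrable fun u => truncatedKernel Ω ε R u * boxAverage z ℓ (x - u) :=
  (integrable_truncatedKernel hn hΩ hhom hint hε hεR).mul_bdd (c := (ℓ ^ n)⁻¹)
    ((measurable_boxAverage z ℓ).comp (measurable_const.sub measurable_id)).aestronglyMeasurable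
    (.of_forall fun _ => abs_boxAverage_le z hℓ _)

/-- Cancellation near the origin: the kernel truncated to `ε ≤ |x| < s` acts on a normalized cube
with an `L¹` gain. -/
theorem lintegral_truncatedKernel_boxAverage_near_le (hn : 1 ≤ n) (hΩ : Measurable Ω)
    (hodd : ∀ x : EuclideanSpace ℝ (Fin n), x ≠ 0 → Ω (-x) = -Ω x)
    (hhom : ∀ x : EuclideanSpace ℝ (Fin n), x ≠ 0 → ∀ δ : ℝ, 0 < δ → Ω (δ • x) = Ω x)
    (hint : Integrable (fun θ : sphere (0 : EuclideanSpace ℝ (Fin n)) 1 => Ω θ)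
        (volume : Measure (EuclideanSpace ℝ (Fin n))).toSphere)
    {ε s ℓ : ℝ} (hε : 0 < ε) (hεs : ε ≤ s) (hℓ : 0 < ℓ) (hsℓ : 2 * s ≤ ℓ)
    (z : EuclideanSpace ℝ (Fin n)) :
    ∫⁻ x, ‖∫ u, truncatedKernel Ω ε s u * boxAverage z ℓ (x - u)‖ₑ ≤
      ENNReal.ofReal (4 * n * s / ℓ * sphereL1Norm Ω) := by
  have hk := integrable_truncatedKernel hn hΩ hhom hint hε hεs
  have hkm := measurable_truncatedKernel hΩ ε s
  have hbm := measurable_boxAverage z ℓ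
  have hk0 : ∫ u, truncatedKernel Ω ε s u = 0 := by
    have := integral_neg_eq_self (truncatedKernel Ω ε s) volume
    simp only [truncatedKernel_neg hodd hε, integral_neg] at this
    linarith
  have hpt : ∀ x, ‖∫ u, truncatedKernel Ω ε s u * boxAverage z ℓ (x - u)‖ₑ ≤
      ∫⁻ u, ‖truncatedKernel Ω ε s u‖ₑ * ‖boxAverage z ℓ (x - u) - boxAverage z ℓ x‖ₑ := by
    intro x
    have : ∫ u, truncatedKernel Ω ε s u * boxAverage z ℓ (x - u) =
        ∫ u, truncatedKernel Ω ε s u * (boxAverage z ℓ (x - u) - boxAverage z ℓ x) := by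
      simp only [mul_sub]
      rw [integral_sub (integrable_truncatedKernel_mul_boxAverage hn hΩ hhom hint hε hεs hℓ.le z x)
        (hk.mul_const _), integral_mul_const, hk0, zero_mul, sub_zero]
    rw [this]
    exact enorm_integral_mul_le_lintegral _ _
  calc _ ≤ _ := lintegral_mono hpt
    _ = ∫⁻ u, ∫⁻ x, ‖truncatedKernel Ω ε s u‖ₑ *
          ‖boxAverage z ℓ (x - u) - boxAverage z ℓ x‖ₑ :=
        lintegral_lintegral_swap (by
          refine Measurable.aemeasurable ?_
          simp only [Function.uncurry_def]
          fun_prop)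
    _ ≤ ∫⁻ u in {u | ‖u‖ < s}, ENNReal.ofReal (4 * n / ℓ) *
          (‖homogeneousKernel Ω u‖ₑ * ENNReal.ofReal ‖u‖) := by
        have hm : MeasurableSet {u : EuclideanSpace ℝ (Fin n) | ‖u‖ < s} :=
          measurable_norm (measurableSet_Iio (a := s))
        rw [← lintegral_indicator hm]
        refine lintegral_mono fun u => ?_
        rw [lintegral_const_mul _ (by fun_prop)]
        by_cases hu : ε ≤ ‖u‖ ∧ ‖u‖ < s
        · rw [truncatedKernel, indicator_of_mem (by exact hu), indicator_of_mem (by exact hu.2)]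
          refine (mul_le_mul_right (lintegral_boxAverage_sub_le z u hℓ (by linarith [hu.2])) _).trans
            (le_of_eq ?_)
          rw [show 4 * n * ‖u‖ / ℓ = 4 * n / ℓ * ‖u‖ by ring, ENNReal.ofReal_mul (by positivity)]
          ring
        · rw [truncatedKernel, indicator_of_notMem (by exact hu)]
          simp
    _ = _ := by
        rw [lintegral_const_mul _ (by have := measurable_homogeneousKernel hΩ; fun_prop),
          setLIntegral_homogeneousKernel_mul_norm hn hΩ hhom hint,
          ← ENNReal.ofReal_mul (by positivity)]
        congr 1
        ring

/-- The action on a normalized cube of the kernel truncated away from the origin, in a ball. -/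
theorem setLIntegral_truncatedKernel_boxAverage_ball_le (hn : 1 ≤ n) (hΩ : Measurable Ω)
    (hhom : ∀ x : EuclideanSpace ℝ (Fin n), x ≠ 0 → ∀ δ : ℝ, 0 < δ → Ω (δ • x) = Ω x)
    (hint : Integrable (fun θ : sphere (0 : EuclideanSpace ℝ (Fin n)) 1 => Ω θ)
        (volume : Measure (EuclideanSpace ℝ (Fin n))).toSphere)
    {s R ℓ L : ℝ} (hs : 0 < s) (hsL : s ≤ L) (hℓ : 0 < ℓ)
    {z c : EuclideanSpace ℝ (Fin n)} (hc : c ∈ box z ℓ) :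
    ∫⁻ x in {x | ‖x - c‖ ≤ L}, ‖∫ u, truncatedKernel Ω s R u * boxAverage z ℓ (x - u)‖ₑ ≤
      ENNReal.ofReal (sphereL1Norm Ω * Real.log ((L + n * ℓ) / s)) := by
  have hkm := measurable_truncatedKernel hΩ s R
  have hKm := measurable_homogeneousKernel hΩ
  have hbm := measurable_boxAverage z ℓ
  have hmL : MeasurableSet {x : EuclideanSpace ℝ (Fin n) | ‖x - c‖ ≤ L} :=
    (measurable_norm.comp (measurable_id.sub_const c)) measurableSet_Iic
  have hmA : MeasurableSet {x : EuclideanSpace ℝ (Fin n) | s ≤ ‖x‖ ∧ ‖x‖ ≤ L + n * ℓ} :=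
    measurable_norm (measurableSet_Icc (a := s) (b := L + n * ℓ))
  have hsL' : s ≤ L + n * ℓ := by
    have : (0 : ℝ) ≤ n * ℓ := by positivity
    linarith
  rw [← setLIntegral_homogeneousKernel_annulus hn hΩ hhom hint hs hsL',
    ← lintegral_indicator hmL, ← lintegral_indicator hmA]
  calc _ ≤ ∫⁻ x, ∫⁻ u, {u | s ≤ ‖u‖ ∧ ‖u‖ ≤ L + n * ℓ}.indicator
          (fun u => ‖homogeneousKernel Ω u‖ₑ) u * ‖boxAverage z ℓ (x - u)‖ₑ := by
        refine lintegral_mono fun x => ?_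
        by_cases hx : ‖x - c‖ ≤ L
        · rw [indicator_of_mem (by exact hx)]
          refine (enorm_integral_mul_le_lintegral _ _).trans (lintegral_mono fun u => ?_)
          by_cases hb : x - u ∈ box z ℓ
          · refine mul_le_mul_left ?_ _
            by_cases hu : s ≤ ‖u‖ ∧ ‖u‖ < R
            · have h1 := norm_sub_le_of_mem_box hℓ.le hb hc
              have h2 : ‖u‖ ≤ L + n * ℓ := by
                have : u = (x - c) - (x - u - c) := by abel
                rw [this]
                exact (norm_sub_le _ _).trans (add_le_add hx h1)
              rw [truncatedKernel, indicator_of_mem (by exact hu),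
                indicator_of_mem (by exact ⟨hu.1, h2⟩)]
            · rw [truncatedKernel, indicator_of_notMem (by exact hu)]
              simp
          · simp [boxAverage, hb]
        · rw [indicator_of_notMem (by exact hx)]
          exact zero_le
    _ = ∫⁻ u, ∫⁻ x, {u | s ≤ ‖u‖ ∧ ‖u‖ ≤ L + n * ℓ}.indicator
          (fun u => ‖homogeneousKernel Ω u‖ₑ) u * ‖boxAverage z ℓ (x - u)‖ₑ :=
        lintegral_lintegral_swap (by
          refine Measurable.aemeasurable ?_
          have := hKm.enorm.indicator hmA
          simp only [Function.uncurry_def]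
          fun_prop)
    _ = _ := by
        refine lintegral_congr fun u => ?_
        rw [lintegral_const_mul _ (by fun_prop),
          lintegral_sub_right_eq_self (fun x => ‖boxAverage z ℓ x‖ₑ),
          lintegral_enorm_boxAverage z hℓ, mul_one]

/-- Away from the cube, replacing a Dirac mass by the normalized cube costs a bounded amount, by
smoothness of the kernel. -/
theorem setLIntegral_dirac_sub_boxAverage_far_le (hn : 1 ≤ n) (hΩ : Measurable Ω)
    (hhom : ∀ x : EuclideanSpace ℝ (Fin n), x ≠ 0 → ∀ δ : ℝ, 0 < δ → Ω (δ • x) = Ω x)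
    (hint : Integrable (fun θ : sphere (0 : EuclideanSpace ℝ (Fin n)) 1 => Ω θ)
        (volume : Measure (EuclideanSpace ℝ (Fin n))).toSphere)
    {A : ℝ} (hA : 1 ≤ A)
    (hsm : ∀ ξ : EuclideanSpace ℝ (Fin n), ‖ξ‖ = 1 → ∀ δ : ℝ, 0 < δ → δ < 1 / n →
        (∫ θ : sphere (0 : EuclideanSpace ℝ (Fin n)) 1,
            |Ω ((θ : EuclideanSpace ℝ (Fin n)) - δ • ξ) - Ω θ|
            ∂(volume : Measure (EuclideanSpace ℝ (Fin n))).toSphere) ≤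
          A * n * δ * sphereL1Norm Ω)
    {ε R ℓ ρ : ℝ} (hε : 0 < ε) (hℓ : 0 < ℓ) (hεℓ : ε ≤ n * ℓ)
    {z c : EuclideanSpace ℝ (Fin n)} (hc : c ∈ box z ℓ) (hR : ρ + ‖c‖ + n * ℓ ≤ R) :
    ∫⁻ x in {x | ‖x‖ < ρ ∧ 2 * n * (n * ℓ) < ‖x - c‖}, ‖homogeneousKernel Ω (x - c) -
        ∫ u, truncatedKernel Ω ε R u * boxAverage z ℓ (x - u)‖ₑ ≤
      ENNReal.ofReal (2 * A * sphereL1Norm Ω) := by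
  have hn' : (1 : ℝ) ≤ n := by exact_mod_cast hn
  have hnℓ : 0 < n * ℓ := by positivity
  have hKm := measurable_homogeneousKernel hΩ
  have hbm := measurable_boxAverage z ℓ
  have hmx : MeasurableSet {x : EuclideanSpace ℝ (Fin n) |
      ‖x‖ < ρ ∧ 2 * n * (n * ℓ) < ‖x - c‖} :=
    (measurable_norm measurableSet_Iio).inter
      ((measurable_norm.comp (measurable_id.sub_const c)) measurableSet_Ioi)
  have hpt : ∀ x, ‖x‖ < ρ ∧ 2 * n * (n * ℓ) < ‖x - c‖ →
      ‖homogeneousKernel Ω (x - c) -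
        ∫ u, truncatedKernel Ω ε R u * boxAverage z ℓ (x - u)‖ₑ ≤
      ∫⁻ y, ‖boxAverage z ℓ y‖ₑ *
        ‖homogeneousKernel Ω (x - c) - homogeneousKernel Ω (x - y)‖ₑ := by
    rintro x ⟨hxρ, hx⟩
    have hR0 : ε ≤ R := by linarith [norm_nonneg x, norm_nonneg c]
    have hi : Integrable fun y => boxAverage z ℓ y * truncatedKernel Ω ε R (x - y) := by
      have := (integrable_truncatedKernel_mul_boxAverage hn hΩ hhom hint hε hR0 hℓ.le z
        x).comp_sub_left x
      simpa only [sub_sub_cancel, mul_comm] using this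
    have e1 : ∫ u, truncatedKernel Ω ε R u * boxAverage z ℓ (x - u) =
        ∫ y, boxAverage z ℓ y * truncatedKernel Ω ε R (x - y) := by
      rw [← integral_sub_left_eq_self (fun u => truncatedKernel Ω ε R u * boxAverage z ℓ (x - u))
        volume x]
      simp only [sub_sub_cancel, mul_comm]
    have e2 : homogeneousKernel Ω (x - c) = ∫ y, boxAverage z ℓ y * homogeneousKernel Ω (x - c) := by
      rw [integral_mul_const, integral_boxAverage z hℓ, one_mul]
    have e3 : homogeneousKernel Ω (x - c) -
        ∫ u, truncatedKernel Ω ε R u * boxAverage z ℓ (x - u) =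
        ∫ y, boxAverage z ℓ y * (homogeneousKernel Ω (x - c) - truncatedKernel Ω ε R (x - y)) := by
      simp only [mul_sub]
      rw [integral_sub ((integrable_boxAverage z hℓ).mul_const _) hi, e1, ← e2]
    rw [e3]
    refine (enorm_integral_mul_le_lintegral _ _).trans (lintegral_mono fun y => ?_)
    by_cases hy : y ∈ box z ℓ
    · have h1 := norm_sub_le_of_mem_box hℓ.le hy hc
      have h2 : ‖x - c‖ ≤ ‖x - y‖ + ‖y - c‖ := norm_sub_le_norm_sub_add_norm_sub x y c
      have h3 : ‖x - y‖ < R := by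
        have : x - y = x - c - (y - c) := by abel
        rw [this]
        linarith [norm_sub_le (x - c) (y - c), norm_sub_le x c]
      have h4 : ε ≤ ‖x - y‖ := by nlinarith
      rw [truncatedKernel, indicator_of_mem (by exact ⟨h4, h3⟩)]
    · simp [boxAverage, hy]
  calc _ ≤ ∫⁻ x in {x | 2 * n * (n * ℓ) < ‖x - c‖}, ∫⁻ y, ‖boxAverage z ℓ y‖ₑ *
        ‖homogeneousKernel Ω (x - c) - homogeneousKernel Ω (x - y)‖ₑ :=
        (setLIntegral_mono' hmx hpt).trans (lintegral_mono_set fun x hx => hx.2)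
    _ = ∫⁻ y, ∫⁻ x in {x | 2 * n * (n * ℓ) < ‖x - c‖}, ‖boxAverage z ℓ y‖ₑ *
        ‖homogeneousKernel Ω (x - c) - homogeneousKernel Ω (x - y)‖ₑ :=
        lintegral_lintegral_swap (by
          refine Measurable.aemeasurable ?_
          simp only [Function.uncurry_def]
          fun_prop)
    _ ≤ ∫⁻ y, ‖boxAverage z ℓ y‖ₑ * ENNReal.ofReal (2 * A * sphereL1Norm Ω) := by
        refine lintegral_mono fun y => ?_
        rw [lintegral_const_mul _ (by fun_prop)]
        by_cases hy : y ∈ box z ℓ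
        · refine mul_le_mul_right ?_ _
          have h1 := norm_sub_le_of_mem_box hℓ.le hy hc
          have h2 := setLIntegral_homogeneousKernel_sub_le hn hΩ hhom hint hA hsm (y := y - c)
            (R := 2 * n * (n * ℓ)) (by positivity) (by gcongr)
          refine le_trans (le_of_eq ?_) h2
          have hm : MeasurableSet {x : EuclideanSpace ℝ (Fin n) | 2 * n * (n * ℓ) < ‖x‖} :=
            measurable_norm (measurableSet_Ioi (a := 2 * n * (n * ℓ)))
          have hmc : MeasurableSet {x : EuclideanSpace ℝ (Fin n) | 2 * n * (n * ℓ) < ‖x - c‖} :=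
            (measurable_norm.comp (measurable_id.sub_const c)) measurableSet_Ioi
          rw [← lintegral_indicator hm, ← lintegral_indicator hmc,
            ← lintegral_sub_right_eq_self ({x | 2 * n * (n * ℓ) < ‖x‖}.indicator _) c]
          refine lintegral_congr fun x => ?_
          simp only [indicator, mem_ofPred_eq]
          rw [sub_sub_sub_cancel_right, enorm_sub_rev]
        · simp [boxAverage, hy]
    _ = _ := by
        rw [lintegral_mul_const _ (by fun_prop), lintegral_enorm_boxAverage z hℓ, one_mul]

theorem truncatedKernel_eq_add {ε s R : ℝ} (hεs : ε ≤ s) (hsR : s ≤ R)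
    (u : EuclideanSpace ℝ (Fin n)) :
    truncatedKernel Ω ε R u = truncatedKernel Ω ε s u + truncatedKernel Ω s R u := by
  simp only [truncatedKernel, indicator, mem_ofPred_eq]
  rcases lt_or_ge ‖u‖ s with h | h
  · have h1 : ¬ s ≤ ‖u‖ := not_le.2 h
    have h2 : ‖u‖ < R := h.trans_le hsR
    simp [h, h1, h2]
  · have h1 : ¬ ‖u‖ < s := not_lt.2 h
    have h2 : ε ≤ ‖u‖ := hεs.trans h
    simp [h, h1, h2]

theorem measurable_truncatedKernel_boxAverage (hΩ : Measurable Ω) (ε R ℓ : ℝ)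
    (z : EuclideanSpace ℝ (Fin n)) :
    Measurable fun x => ∫ u, truncatedKernel Ω ε R u * boxAverage z ℓ (x - u) := by
  have hkm := measurable_truncatedKernel hΩ ε R
  have hbm := measurable_boxAverage z ℓ
  have : Measurable (Function.uncurry fun x u =>
      truncatedKernel Ω ε R u * boxAverage z ℓ (x - u)) := by
    simp only [Function.uncurry_def]
    fun_prop
  exact this.stronglyMeasurable.integral_prod_right.measurable

/-- Replacing a Dirac mass at `c` by the normalized cube of side `2ℓ` containing it changes the
singular integral by `O(log n)` in `L¹` away from the ball of radius `ℓ / n` around `c`. -/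
theorem setLIntegral_dirac_sub_boxAverage_le (hn : 2 ≤ n) (hΩ : Measurable Ω)
    (hodd : ∀ x : EuclideanSpace ℝ (Fin n), x ≠ 0 → Ω (-x) = -Ω x)
    (hhom : ∀ x : EuclideanSpace ℝ (Fin n), x ≠ 0 → ∀ δ : ℝ, 0 < δ → Ω (δ • x) = Ω x)
    (hint : Integrable (fun θ : sphere (0 : EuclideanSpace ℝ (Fin n)) 1 => Ω θ)
        (volume : Measure (EuclideanSpace ℝ (Fin n))).toSphere)
    {A : ℝ} (hA : 1 ≤ A)
    (hsm : ∀ ξ : EuclideanSpace ℝ (Fin n), ‖ξ‖ = 1 → ∀ δ : ℝ, 0 < δ → δ < 1 / n →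
        (∫ θ : sphere (0 : EuclideanSpace ℝ (Fin n)) 1,
            |Ω ((θ : EuclideanSpace ℝ (Fin n)) - δ • ξ) - Ω θ|
            ∂(volume : Measure (EuclideanSpace ℝ (Fin n))).toSphere) ≤
          A * n * δ * sphereL1Norm Ω)
    {ε R ℓ ρ : ℝ} (hε : 0 < ε) (hℓ : 0 < ℓ) (hεℓ : ε ≤ ℓ / n) (hρ : 0 ≤ ρ)
    {z c : EuclideanSpace ℝ (Fin n)} (hc : c ∈ box z (2 * ℓ))
    (hR : ρ + ‖c‖ + n * (2 * ℓ) ≤ R) :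
    ∫⁻ x in {x | ‖x‖ < ρ ∧ ℓ / n ≤ ‖x - c‖}, ‖homogeneousKernel Ω (x - c) -
        ∫ u, truncatedKernel Ω ε R u * boxAverage z (2 * ℓ) (x - u)‖ₑ ≤
      ENNReal.ofReal ((4 * A + 12 * Real.log n) * sphereL1Norm Ω) := by
  have hn1 : 1 ≤ n := by omega
  have hn2 : (2 : ℝ) ≤ n := by exact_mod_cast hn
  have hM : 0 ≤ sphereL1Norm Ω := sphereL1Norm_nonneg
  set s := ℓ / n with hs
  set L := 2 * n * (n * (2 * ℓ)) with hL
  have hs0 : 0 < s := by positivity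
  have hsℓ : s * n = ℓ := by rw [hs]; field_simp
  have hsℓ' : 2 * s ≤ ℓ := by nlinarith
  have hsn : s ≤ n * (2 * ℓ) := by nlinarith
  have hsL : s ≤ L := by nlinarith
  have hsR : s ≤ R := by linarith [norm_nonneg c]
  have hKm := measurable_homogeneousKernel hΩ
  have hbm := measurable_boxAverage z (2 * ℓ)
  set g : ℝ → ℝ → EuclideanSpace ℝ (Fin n) → ℝ := fun α β x =>
    ∫ u, truncatedKernel Ω α β u * boxAverage z (2 * ℓ) (x - u) with hg
  have hgm : ∀ α β, Measurable (g α β) := fun α β =>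
    measurable_truncatedKernel_boxAverage hΩ α β (2 * ℓ) z
  have hgadd : ∀ x, g ε R x = g ε s x + g s R x := fun x => by
    simp only [hg, truncatedKernel_eq_add hεℓ hsR, add_mul]
    exact integral_add
      (integrable_truncatedKernel_mul_boxAverage hn1 hΩ hhom hint hε hεℓ (by positivity) z x)
      (integrable_truncatedKernel_mul_boxAverage hn1 hΩ hhom hint hs0 hsR (by positivity) z x)
  have hfar := setLIntegral_dirac_sub_boxAverage_far_le hn1 hΩ hhom hint hA hsm hε
    (by positivity : 0 < 2 * ℓ) (hεℓ.trans hsn) hc hR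
  have h1 := lintegral_truncatedKernel_boxAverage_near_le hn1 hΩ hodd hhom hint hε hεℓ
    (by positivity : 0 < 2 * ℓ) (by linarith) z
  have h2 := setLIntegral_truncatedKernel_boxAverage_ball_le (R := R) hn1 hΩ hhom hint hs0 hsL
    (by positivity : 0 < 2 * ℓ) hc
  have h3 : ∫⁻ x in {x | s ≤ ‖x - c‖ ∧ ‖x - c‖ ≤ L}, ‖homogeneousKernel Ω (x - c)‖ₑ =
      ENNReal.ofReal (sphereL1Norm Ω * Real.log (L / s)) := by
    rw [← setLIntegral_homogeneousKernel_annulus hn1 hΩ hhom hint hs0 hsL]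
    have hm : MeasurableSet {x : EuclideanSpace ℝ (Fin n) | s ≤ ‖x‖ ∧ ‖x‖ ≤ L} :=
      measurable_norm (measurableSet_Icc (a := s) (b := L))
    have hmc : MeasurableSet {x : EuclideanSpace ℝ (Fin n) | s ≤ ‖x - c‖ ∧ ‖x - c‖ ≤ L} :=
      (measurable_norm.comp (measurable_id.sub_const c)) (measurableSet_Icc (a := s) (b := L))
    rw [← lintegral_indicator hm, ← lintegral_indicator hmc,
      ← lintegral_sub_right_eq_self ({x | s ≤ ‖x‖ ∧ ‖x‖ ≤ L}.indicator _) c]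
    rfl
  have hlog : ∀ t, 0 < t → t ≤ 6 * (n : ℝ) ^ 3 → Real.log t ≤ 6 * Real.log n := fun t ht htn => by
    rw [show 6 * Real.log n = Real.log ((n : ℝ) ^ 6) by rw [Real.log_pow]; norm_num]
    refine Real.log_le_log ht (htn.trans ?_)
    have : (2 : ℝ) ^ 3 ≤ (n : ℝ) ^ 3 := by gcongr
    nlinarith
  have e1 : L / s = 4 * (n : ℝ) ^ 3 := by rw [hL, ← hsℓ]; field_simp; ring
  have e2 : (L + n * (2 * ℓ)) / s = 4 * (n : ℝ) ^ 3 + 2 * (n : ℝ) ^ 2 := by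
    rw [hL, ← hsℓ]; field_simp; ring
  have e3 : 4 * n * s / (2 * ℓ) = 2 := by rw [← hsℓ]; field_simp; ring
  have h32 : 2 * (n : ℝ) ^ 2 ≤ (n : ℝ) ^ 3 := by nlinarith [sq_nonneg (n : ℝ)]
  rw [e1] at h3
  rw [e2] at h2
  rw [e3] at h1
  have hl1 := hlog (4 * (n : ℝ) ^ 3) (by positivity) (by nlinarith [sq_nonneg (n : ℝ)])
  have hl2 := hlog (4 * (n : ℝ) ^ 3 + 2 * (n : ℝ) ^ 2) (by positivity)
    (by nlinarith [sq_nonneg (n : ℝ)])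
  have hone : ∀ t : ℝ, 1 ≤ t → 0 ≤ Real.log t := fun t ht => Real.log_nonneg ht
  have hn3 : (2 : ℝ) ^ 3 ≤ (n : ℝ) ^ 3 := by gcongr
  have hl1' := hone (4 * (n : ℝ) ^ 3) (by linarith)
  have hl2' := hone (4 * (n : ℝ) ^ 3 + 2 * (n : ℝ) ^ 2) (by nlinarith [sq_nonneg (n : ℝ)])
  have hnear : ∫⁻ x in {x | s ≤ ‖x - c‖ ∧ ‖x - c‖ ≤ L},
      ‖homogeneousKernel Ω (x - c) - g ε R x‖ₑ ≤
      ENNReal.ofReal (sphereL1Norm Ω * Real.log (4 * (n : ℝ) ^ 3)) +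
        (ENNReal.ofReal (2 * sphereL1Norm Ω) +
        ENNReal.ofReal (sphereL1Norm Ω *
          Real.log (4 * (n : ℝ) ^ 3 + 2 * (n : ℝ) ^ 2))) := by
    have hk1 := hgm ε s
    have hk2 := hgm s R
    calc _ ≤ ∫⁻ x in {x | s ≤ ‖x - c‖ ∧ ‖x - c‖ ≤ L},
          (‖homogeneousKernel Ω (x - c)‖ₑ + (‖g ε s x‖ₑ + ‖g s R x‖ₑ)) := by
          refine lintegral_mono fun x => ?_
          rw [hgadd]
          exact (enorm_sub_le).trans (add_le_add_right (enorm_add_le _ _) _)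
      _ ≤ _ := by
          rw [lintegral_add_left (by fun_prop), lintegral_add_left (by fun_prop)]
          exact add_le_add h3.le (add_le_add ((setLIntegral_le_lintegral _ _).trans h1)
            ((lintegral_mono_set fun x hx => hx.2).trans h2))
  have hsub : {x : EuclideanSpace ℝ (Fin n) | ‖x‖ < ρ ∧ s ≤ ‖x - c‖} ⊆
      {x | ‖x‖ < ρ ∧ L < ‖x - c‖} ∪ {x | s ≤ ‖x - c‖ ∧ ‖x - c‖ ≤ L} := fun x hx => by
    rcases lt_or_ge L ‖x - c‖ with h | h
    · exact .inl ⟨hx.1, h⟩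
    · exact .inr ⟨hx.2, h⟩
  refine (lintegral_mono_set hsub).trans ((lintegral_union_le _ _ _).trans
    ((add_le_add hfar hnear).trans ?_))
  rw [← ENNReal.ofReal_add (by positivity) (mul_nonneg hM hl2'),
    ← ENNReal.ofReal_add (mul_nonneg hM hl1') (add_nonneg (by positivity) (mul_nonneg hM hl2')),
    ← ENNReal.ofReal_add (by positivity) (by positivity)]
  refine ENNReal.ofReal_le_ofReal ?_
  nlinarith [mul_le_mul_of_nonneg_left hl1 hM, mul_le_mul_of_nonneg_left hl2 hM,
    mul_le_mul_of_nonneg_left hA hM]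

end SingleDirac

/-- The lower corner of the dyadic cube of side `2 ^ j` containing `x`. -/
noncomputable def dyadicCorner {n : ℕ} (j : ℤ) (x : EuclideanSpace ℝ (Fin n)) :
    EuclideanSpace ℝ (Fin n) :=
  WithLp.toLp 2 fun i => 2 ^ j * (⌊x i / 2 ^ j⌋ : ℝ)

/-- The dyadic cube of side `2 ^ j` containing `x`. -/
noncomputable def dyadicCube {n : ℕ} (j : ℤ) (x : EuclideanSpace ℝ (Fin n)) :
    Set (EuclideanSpace ℝ (Fin n)) :=
  box (dyadicCorner j x) (2 ^ j)

/-- The mass that `∑ k, a k • δ_{c k}` gives to the dyadic cube of side `2 ^ j` containing `x`. -/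
noncomputable def dyadicMass {n N : ℕ} (c : Fin N → EuclideanSpace ℝ (Fin n)) (a : Fin N → ℝ)
    (j : ℤ) (x : EuclideanSpace ℝ (Fin n)) : ℝ :=
  ∑ k, (dyadicCube j x).indicator (fun _ => a k) (c k)

section Dyadic

open scoped ENNReal

variable {n N : ℕ}

theorem mem_dyadicCube_iff {j : ℤ} {x y : EuclideanSpace ℝ (Fin n)} :
    y ∈ dyadicCube j x ↔ ∀ i, ⌊y i / 2 ^ j⌋ = ⌊x i / 2 ^ j⌋ := by
  have h2 : (0 : ℝ) < 2 ^ j := by positivity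
  refine forall_congr' fun i => ?_
  rw [Int.floor_eq_iff, le_div_iff₀ h2, div_lt_iff₀ h2]
  simp only [dyadicCorner, mul_comm, mul_add_one]

theorem mem_dyadicCube_self (j : ℤ) (x : EuclideanSpace ℝ (Fin n)) : x ∈ dyadicCube j x :=
  mem_dyadicCube_iff.2 fun _ => rfl

theorem mem_dyadicCube_symm {j : ℤ} {x y : EuclideanSpace ℝ (Fin n)} (h : y ∈ dyadicCube j x) :
    x ∈ dyadicCube j y :=
  mem_dyadicCube_iff.2 fun i => (mem_dyadicCube_iff.1 h i).symm

theorem dyadicCorner_eq_of_mem {j : ℤ} {x y : EuclideanSpace ℝ (Fin n)}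
    (h : y ∈ dyadicCube j x) : dyadicCorner j y = dyadicCorner j x := by
  ext i
  simp only [dyadicCorner, mem_dyadicCube_iff.1 h i]

theorem dyadicCube_eq_of_mem {j : ℤ} {x y : EuclideanSpace ℝ (Fin n)}
    (h : y ∈ dyadicCube j x) : dyadicCube j y = dyadicCube j x := by
  rw [dyadicCube, dyadicCube, dyadicCorner_eq_of_mem h]

theorem dyadicCube_mono {j j' : ℤ} (hj : j ≤ j') (x : EuclideanSpace ℝ (Fin n)) :
    dyadicCube j x ⊆ dyadicCube j' x := by
  induction j', hj using Int.leInduction with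
  | base => exact subset_rfl
  | succ m _ ih =>
    refine ih.trans fun y hy => mem_dyadicCube_iff.2 fun i => ?_
    have h : ∀ t : ℝ, ⌊t / 2 ^ (m + 1)⌋ = ⌊t / 2 ^ m⌋ / 2 := fun t => by
      rw [zpow_add_one₀ two_ne_zero, ← div_div]
      exact_mod_cast Int.floor_div_natCast (t / 2 ^ m) 2
    rw [h, h, mem_dyadicCube_iff.1 hy i]

theorem dyadicMass_eq_of_mem {c : Fin N → EuclideanSpace ℝ (Fin n)} {a : Fin N → ℝ} {j : ℤ}
    {x y : EuclideanSpace ℝ (Fin n)} (h : y ∈ dyadicCube j x) :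
    dyadicMass c a j y = dyadicMass c a j x := by
  rw [dyadicMass, dyadicMass, dyadicCube_eq_of_mem h]

/-- The stopping-time selection: the largest scale at which the dyadic cube around `c k` has
density greater than `lam`. -/
theorem exists_stopping_scale (hn : 1 ≤ n) (c : Fin N → EuclideanSpace ℝ (Fin n)) {a : Fin N → ℝ}
    (ha : ∀ k, 0 < a k) {lam : ℝ} (hlam : 0 < lam) (k : Fin N) :
    ∃ J : ℤ, lam * (2 ^ J) ^ n < dyadicMass c a J (c k) ∧
      ∀ j, J < j → dyadicMass c a j (c k) ≤ lam * (2 ^ j) ^ n := by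
  have hle : ∀ j, dyadicMass c a j (c k) ≤ ∑ l, a l := fun j =>
    Finset.sum_le_sum fun l _ => indicator_le_self' (fun _ _ => (ha l).le) _
  have hge : ∀ j, a k ≤ dyadicMass c a j (c k) := fun j => by
    have := Finset.single_le_sum (f := fun l => (dyadicCube j (c k)).indicator (fun _ => a l) (c l))
      (fun l _ => indicator_nonneg (fun _ _ => (ha l).le) _) (Finset.mem_univ k)
    rw [indicator_of_mem (mem_dyadicCube_self j (c k))] at this
    exact this
  have hbdd : ∃ b : ℤ, ∀ z : ℤ, lam * (2 ^ z) ^ n < dyadicMass c a z (c k) → z ≤ b := by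
    obtain ⟨b, hb⟩ := pow_unbounded_of_one_lt ((∑ l, a l) / lam) one_lt_two
    refine ⟨b, fun z hz => ?_⟩
    by_contra! hbz
    have h1 : (2 : ℝ) ^ b ≤ 2 ^ z := by
      rw [← zpow_natCast]
      exact zpow_le_zpow_right₀ one_le_two hbz.le
    have h2 : (2 : ℝ) ^ z ≤ (2 ^ z) ^ n :=
      le_self_pow₀ ((one_le_pow₀ one_le_two).trans h1) (by omega)
    rw [div_lt_iff₀ hlam] at hb
    nlinarith [hle z]
  have hinh : ∃ z : ℤ, lam * (2 ^ z) ^ n < dyadicMass c a z (c k) := by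
    obtain ⟨b, hb⟩ := exists_pow_lt_of_lt_one (div_pos (ha k) hlam) (y := (1 / 2 : ℝ))
      (by norm_num)
    refine ⟨-b, ?_⟩
    have h1 : (2 : ℝ) ^ (-b : ℤ) = (1 / 2) ^ b := by
      rw [zpow_neg, zpow_natCast, one_div, inv_pow]
    have h2 : (((1 : ℝ) / 2) ^ b) ^ n ≤ (1 / 2) ^ b :=
      pow_le_of_le_one (by positivity) (pow_le_one₀ (by norm_num) (by norm_num)) (by omega)
    rw [lt_div_iff₀ hlam] at hb
    rw [h1]
    nlinarith [hge (-b)]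
  obtain ⟨J, hJ, hmax⟩ := Int.exists_greatest_of_bdd hbdd hinh
  exact ⟨J, hJ, fun j hj => not_lt.1 fun h => hj.not_ge (hmax j h)⟩

theorem div_le_norm_sub_of_notMem_box {z x y : EuclideanSpace ℝ (Fin n)} {ℓ t : ℝ}
    (hy : y ∈ box z ℓ) (hx : x ∉ box (WithLp.toLp 2 fun i => z i - t) (ℓ + 2 * t)) :
    t ≤ ‖x - y‖ := by
  by_contra! h
  refine hx fun i => ?_
  have h1 : |x i - y i| < t := (PiLp.norm_apply_le (x - y) i).trans_lt h
  rw [abs_lt] at h1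
  have := hy i
  constructor <;> simp only <;> linarith

theorem one_add_two_div_pow_le (hn : 1 ≤ n) : (1 + 2 / (n : ℝ)) ^ n ≤ Real.exp 2 := by
  have hn' : (0 : ℝ) < n := by exact_mod_cast hn
  calc (1 + 2 / (n : ℝ)) ^ n ≤ Real.exp (2 / n) ^ n := by
        gcongr
        linarith [Real.add_one_le_exp (2 / (n : ℝ))]
    _ = Real.exp 2 := by
        rw [← Real.exp_nat_mul]
        congr 1
        field_simp

/-- Calderón–Zygmund type selection of cubes for a finite combination of Dirac masses. -/
theorem exists_calderonZygmund_cubes (hn : 1 ≤ n) (c : Fin N → EuclideanSpace ℝ (Fin n))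
    {a : Fin N → ℝ} (ha : ∀ k, 0 < a k) {lam : ℝ} (hlam : 0 < lam) :
    ∃ (z : Fin N → EuclideanSpace ℝ (Fin n)) (ℓ : Fin N → ℝ) (S : Set (EuclideanSpace ℝ (Fin n))),
      (∀ k, 0 < ℓ k) ∧ (∀ k, c k ∈ box (z k) (2 * ℓ k)) ∧ MeasurableSet S ∧
      (∀ x ∉ S, ∀ k, ℓ k / n ≤ ‖x - c k‖) ∧
      ENNReal.ofReal lam * volume S ≤ ENNReal.ofReal (Real.exp 2 * ∑ k, a k) ∧
      ∫⁻ x, ‖∑ k, a k * boxAverage (z k) (2 * ℓ k) x‖ₑ ^ 2 ≤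
        ENNReal.ofReal (2 * lam * ∑ k, a k) := by
  choose J hJ hJmax using exists_stopping_scale hn c ha hlam
  have hn' : (0 : ℝ) < n := by exact_mod_cast hn
  set ℓ : Fin N → ℝ := fun k => 2 ^ J k with hℓ
  have hℓ0 : ∀ k, 0 < ℓ k := fun k => by positivity
  have hℓ2 : ∀ k, 2 * ℓ k = 2 ^ (J k + 1) := fun k => by
    rw [zpow_add_one₀ two_ne_zero, mul_comm]
  set z : Fin N → EuclideanSpace ℝ (Fin n) := fun k => dyadicCorner (J k + 1) (c k) with hz
  have hP : ∀ k, box (z k) (2 * ℓ k) = dyadicCube (J k + 1) (c k) := fun k => by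
    rw [hℓ2]
    rfl
  set Q : Fin N → Set (EuclideanSpace ℝ (Fin n)) := fun k =>
    box (WithLp.toLp 2 fun i => dyadicCorner (J k) (c k) i - ℓ k / n) (ℓ k + 2 * (ℓ k / n)) with hQ
  have hQm : ∀ k, MeasurableSet (Q k) := fun k => measurableSet_box _ _
  have hQv : ∀ k, volume (Q k) ≤ ENNReal.ofReal (Real.exp 2 * ℓ k ^ n) := fun k => by
    rw [hQ, volume_box _ (by have := hℓ0 k; positivity)]
    refine ENNReal.ofReal_le_ofReal ?_
    rw [show ℓ k + 2 * (ℓ k / n) = (1 + 2 / (n : ℝ)) * ℓ k by ring, mul_pow]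
    have := hℓ0 k
    gcongr
    exact one_add_two_div_pow_le hn
  have hJeq : ∀ k l, c l ∈ dyadicCube (J k) (c k) → J l = J k := fun k l h => by
    have h1 : J k ≤ J l := by
      by_contra! h1
      have := hJmax l _ h1
      rw [dyadicMass_eq_of_mem h] at this
      exact this.not_gt (hJ k)
    refine le_antisymm ?_ h1
    by_contra! h2
    have h3 : c k ∈ dyadicCube (J l) (c l) := dyadicCube_mono h1 _ (mem_dyadicCube_symm h)
    have := hJmax k _ h2
    rw [dyadicMass_eq_of_mem h3] at this
    exact this.not_gt (hJ l)
  set m : Fin N → ℝ := fun k => dyadicMass c a (J k) (c k) with hm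
  have hm0 : ∀ k, 0 < m k := fun k => lt_of_le_of_lt (by positivity) (hJ k)
  refine ⟨z, ℓ, ⋃ k, Q k, hℓ0, fun k => hP k ▸ mem_dyadicCube_self _ _,
    MeasurableSet.iUnion hQm, fun x hx k => ?_, ?_, ?_⟩
  · exact div_le_norm_sub_of_notMem_box (mem_dyadicCube_self (J k) (c k))
      fun h => hx (mem_iUnion.2 ⟨k, h⟩)
  · have hcover : ∀ x, (⋃ k, Q k).indicator (1 : EuclideanSpace ℝ (Fin n) → ℝ≥0∞) x ≤
        ∑ l, (Q l).indicator (fun _ => ENNReal.ofReal (a l / m l)) x := by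
      intro x
      by_cases hx : x ∈ ⋃ k, Q k
      · obtain ⟨k, hk⟩ := mem_iUnion.1 hx
        rw [indicator_of_mem hx]
        calc (1 : ℝ≥0∞) = ENNReal.ofReal
              (∑ l, (dyadicCube (J k) (c k)).indicator (fun _ => a l) (c l) / m k) := by
              rw [← Finset.sum_div]
              change 1 = ENNReal.ofReal (m k / m k)
              rw [div_self (hm0 k).ne', ENNReal.ofReal_one]
          _ = ∑ l, ENNReal.ofReal
              ((dyadicCube (J k) (c k)).indicator (fun _ => a l) (c l) / m k) :=
              ENNReal.ofReal_sum_of_nonneg fun l _ =>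
                div_nonneg (indicator_nonneg (fun _ _ => (ha l).le) _) (hm0 k).le
          _ ≤ _ := by
              refine Finset.sum_le_sum fun l _ => ?_
              by_cases hl : c l ∈ dyadicCube (J k) (c k)
              · have e := hJeq k l hl
                have hQl : Q l = Q k := by
                  simp only [hQ, hℓ, e, dyadicCorner_eq_of_mem hl]
                have hml : m l = m k := by
                  simp only [hm, e, dyadicMass_eq_of_mem hl]
                rw [hQl, hml, indicator_of_mem hl, indicator_of_mem hk]
              · simp [hl]
      · simp [hx]
    have hvol : volume (⋃ k, Q k) ≤ ∑ l, ENNReal.ofReal (Real.exp 2 * a l / lam) := by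
      rw [← lintegral_indicator_one (MeasurableSet.iUnion hQm)]
      refine (lintegral_mono hcover).trans ?_
      rw [lintegral_finsetSum _ fun l _ => measurable_const.indicator (hQm l)]
      refine Finset.sum_le_sum fun l _ => ?_
      rw [lintegral_indicator_const (hQm l)]
      refine (mul_le_mul_right (hQv l) _).trans ?_
      rw [← ENNReal.ofReal_mul (div_nonneg (ha l).le (hm0 l).le)]
      refine ENNReal.ofReal_le_ofReal ?_
      have h1 : lam * ℓ l ^ n ≤ m l := (hJ l).le
      rw [div_mul_eq_mul_div, div_le_div_iff₀ (hm0 l) hlam]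
      have := mul_le_mul_of_nonneg_left h1 (mul_nonneg (Real.exp_pos 2).le (ha l).le)
      linarith
    refine (mul_le_mul_right hvol _).trans (le_of_eq ?_)
    rw [← ENNReal.ofReal_sum_of_nonneg fun l _ => by have := ha l; positivity,
      ← ENNReal.ofReal_mul hlam.le, ← Finset.sum_div, ← Finset.mul_sum]
    congr 1
    field_simp
  · set φ : Fin N → EuclideanSpace ℝ (Fin n) → ℝ := fun k => boxAverage (z k) (2 * ℓ k) with hφ
    have hφ0 : ∀ k x, 0 ≤ φ k x := fun k x => boxAverage_nonneg _ (by have := hℓ0 k; positivity) x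
    have hφi : ∀ k, Integrable (φ k) := fun k => integrable_boxAverage _ (by have := hℓ0 k; positivity)
    set b : Fin N → Fin N → ℝ := fun k l =>
      (dyadicCube (J k + 1) (c k)).indicator (fun _ => ((2 * ℓ k) ^ n)⁻¹) (c l) with hb
    have hb0 : ∀ k l, 0 ≤ b k l := fun k l =>
      indicator_nonneg (fun _ _ => by have := hℓ0 k; positivity) _
    have hkey : ∀ k l x, J l ≤ J k → φ k x * φ l x ≤ b k l * φ l x := fun k l x hlk => by
      by_cases hxl : x ∈ dyadicCube (J l + 1) (c l)
      · refine mul_le_mul_of_nonneg_right ?_ (hφ0 l x)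
        by_cases hxk : x ∈ dyadicCube (J k + 1) (c k)
        · have h1 : c l ∈ dyadicCube (J k + 1) (c k) := by
            rw [← dyadicCube_eq_of_mem hxk]
            exact dyadicCube_mono (by omega) x (mem_dyadicCube_symm hxl)
          simp only [hφ, hb, boxAverage, hP, indicator_of_mem hxk, indicator_of_mem h1, le_refl]
        · simp only [hφ, boxAverage, hP, indicator_of_notMem hxk]
          exact hb0 k l
      · simp only [hφ, boxAverage, hP, indicator_of_notMem hxl, mul_zero, le_refl]
    have hpair : ∀ k l x, φ k x * φ l x ≤ b k l * φ l x + b l k * φ k x := fun k l x => by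
      rcases le_total (J l) (J k) with h | h
      · linarith [hkey k l x h, mul_nonneg (hb0 l k) (hφ0 k x)]
      · linarith [hkey l k x h, mul_nonneg (hb0 k l) (hφ0 l x), mul_comm (φ k x) (φ l x)]
    have hrow : ∀ k, ∑ l, a l * b k l ≤ lam := fun k => by
      have h1 : ∑ l, a l * b k l = dyadicMass c a (J k + 1) (c k) * ((2 * ℓ k) ^ n)⁻¹ := by
        rw [dyadicMass, Finset.sum_mul]
        refine Finset.sum_congr rfl fun l _ => ?_
        by_cases hl : c l ∈ dyadicCube (J k + 1) (c k) <;> simp [hb, hl]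
      have h2 := hJmax k (J k + 1) (lt_add_one _)
      have := hℓ0 k
      rw [h1, ← div_eq_mul_inv, div_le_iff₀ (by positivity), hℓ2]
      exact h2
    set G : EuclideanSpace ℝ (Fin n) → ℝ := fun x =>
      2 * ∑ k, ∑ l, a k * a l * b k l * φ l x with hG
    have hGi : Integrable G := (integrable_finsetSum _ fun k _ =>
      integrable_finsetSum _ fun l _ => (hφi l).const_mul _).const_mul 2
    have hG0 : ∀ x, 0 ≤ G x := fun x => mul_nonneg zero_le_two <|
      Finset.sum_nonneg fun k _ => Finset.sum_nonneg fun l _ =>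
        mul_nonneg (mul_nonneg (mul_nonneg (ha k).le (ha l).le) (hb0 k l)) (hφ0 l x)
    have hfG : ∀ x, (∑ k, a k * φ k x) ^ 2 ≤ G x := fun x => by
      calc (∑ k, a k * φ k x) ^ 2 = ∑ k, ∑ l, a k * a l * (φ k x * φ l x) := by
            rw [sq, Finset.sum_mul_sum]
            exact Finset.sum_congr rfl fun k _ => Finset.sum_congr rfl fun l _ => by ring
        _ ≤ ∑ k, ∑ l, (a k * a l * b k l * φ l x + a l * a k * b l k * φ k x) := by
            refine Finset.sum_le_sum fun k _ => Finset.sum_le_sum fun l _ => ?_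
            have := mul_le_mul_of_nonneg_left (hpair k l x) (mul_pos (ha k) (ha l)).le
            linarith
        _ = G x := by
            simp only [Finset.sum_add_distrib]
            rw [Finset.sum_comm (f := fun k l => a l * a k * b l k * φ k x), hG]
            ring
    have hGint : ∫ x, G x ≤ 2 * lam * ∑ k, a k := by
      have e : ∫ x, G x = 2 * ∑ k, a k * ∑ l, a l * b k l := by
        simp only [hG]
        rw [integral_const_mul, integral_finsetSum _ fun k _ =>
          integrable_finsetSum _ fun l _ => (hφi l).const_mul _]
        congr 1
        refine Finset.sum_congr rfl fun k _ => ?_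
        rw [integral_finsetSum _ fun l _ => (hφi l).const_mul _, Finset.mul_sum]
        refine Finset.sum_congr rfl fun l _ => ?_
        rw [integral_const_mul, hφ, integral_boxAverage _ (by have := hℓ0 l; positivity)]
        ring
      rw [e, mul_assoc, Finset.mul_sum _ _ lam]
      refine mul_le_mul_of_nonneg_left (Finset.sum_le_sum fun k _ => ?_) zero_le_two
      rw [mul_comm]
      exact mul_le_mul_of_nonneg_right (hrow k) (ha k).le
    calc ∫⁻ x, ‖∑ k, a k * φ k x‖ₑ ^ 2 ≤ ∫⁻ x, ENNReal.ofReal (G x) := by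
          refine lintegral_mono fun x => ?_
          rw [Real.enorm_of_nonneg (Finset.sum_nonneg fun k _ => mul_nonneg (ha k).le (hφ0 k x)),
            ← ENNReal.ofReal_pow (Finset.sum_nonneg fun k _ => mul_nonneg (ha k).le (hφ0 k x))]
          exact ENNReal.ofReal_le_ofReal (hfG x)
      _ = ENNReal.ofReal (∫ x, G x) :=
          (ofReal_integral_eq_lintegral_ofReal hGi (.of_forall hG0)).symm
      _ ≤ _ := ENNReal.ofReal_le_ofReal hGint

end Dyadic

section WeakType

open scoped ENNReal

variable {n N : ℕ} {Ω : EuclideanSpace ℝ (Fin n) → ℝ}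

/-- The weak-type bound inside a ball. -/
theorem weak_type_diracs_ball (hn : 2 ≤ n) (hΩ : Measurable Ω)
    (hodd : ∀ x : EuclideanSpace ℝ (Fin n), x ≠ 0 → Ω (-x) = -Ω x)
    (hhom : ∀ x : EuclideanSpace ℝ (Fin n), x ≠ 0 → ∀ δ : ℝ, 0 < δ → Ω (δ • x) = Ω x)
    (hint : Integrable (fun θ : sphere (0 : EuclideanSpace ℝ (Fin n)) 1 => Ω θ)
        (volume : Measure (EuclideanSpace ℝ (Fin n))).toSphere)
    {A : ℝ} (hA : 1 ≤ A)
    (hsm : ∀ ξ : EuclideanSpace ℝ (Fin n), ‖ξ‖ = 1 → ∀ δ : ℝ, 0 < δ → δ < 1 / n →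
        (∫ θ : sphere (0 : EuclideanSpace ℝ (Fin n)) 1,
            |Ω ((θ : EuclideanSpace ℝ (Fin n)) - δ • ξ) - Ω θ|
            ∂(volume : Measure (EuclideanSpace ℝ (Fin n))).toSphere) ≤
          A * n * δ * sphereL1Norm Ω)
    (c : Fin N → EuclideanSpace ℝ (Fin n)) {a : Fin N → ℝ} (ha : ∀ k, 0 < a k)
    {lam ρ : ℝ} (hlam : 0 < lam) (hρ : 0 ≤ ρ) :
    ENNReal.ofReal lam *
        volume {x | ‖x‖ < ρ ∧ lam < |∑ k, a k * homogeneousKernel Ω (x - c k)|} ≤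
      ENNReal.ofReal ((Real.exp 2 + (8 * A + 24 * Real.log n) * sphereL1Norm Ω +
        128 * sphereL1Norm Ω ^ 2) * ∑ k, a k) := by
  have hn1 : 1 ≤ n := by omega
  have hn' : (0 : ℝ) < n := by exact_mod_cast hn1
  have hM : 0 ≤ sphereL1Norm Ω := sphereL1Norm_nonneg
  have hlog : 0 ≤ Real.log n := Real.log_natCast_nonneg n
  have hKm := measurable_homogeneousKernel hΩ
  have hsum : 0 ≤ ∑ k, a k := Finset.sum_nonneg fun k _ => (ha k).le
  obtain ⟨z, ℓ, S, hℓ, hc, -, hS, hSv, hL2⟩ := exists_calderonZygmund_cubes hn1 c ha hlam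
  obtain ⟨ε, hεℓ, hε⟩ : ∃ ε : ℝ, (∀ k, ε ≤ ℓ k / n) ∧ 0 < ε :=
    ((Filter.eventually_all.2 fun k => (eventually_le_nhds (div_pos (hℓ k) hn')).filter_mono
      nhdsWithin_le_nhds).and (self_mem_nhdsWithin (s := Ioi (0 : ℝ)))).exists
  obtain ⟨R₀, hR₀⟩ := Finite.exists_le fun k => ρ + ‖c k‖ + n * (2 * ℓ k)
  set R := max R₀ ε with hR
  have hεR : ε ≤ R := le_max_right _ _
  have hRk : ∀ k, ρ + ‖c k‖ + n * (2 * ℓ k) ≤ R := fun k => (hR₀ k).trans (le_max_left _ _)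
  set X := (4 * A + 12 * Real.log n) * sphereL1Norm Ω with hX
  have hX0 : 0 ≤ X := by positivity
  set g : Fin N → EuclideanSpace ℝ (Fin n) → ℝ := fun k x =>
    ∫ u, truncatedKernel Ω ε R u * boxAverage (z k) (2 * ℓ k) (x - u) with hg
  have hgm : ∀ k, Measurable (g k) := fun k => measurable_truncatedKernel_boxAverage hΩ _ _ _ _
  set V : Fin N → Set (EuclideanSpace ℝ (Fin n)) := fun k =>
    {x | ‖x‖ < ρ ∧ ℓ k / n ≤ ‖x - c k‖} with hV
  have hVm : ∀ k, MeasurableSet (V k) := fun k =>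
    (measurable_norm measurableSet_Iio).inter
      ((measurable_norm.comp (measurable_id.sub_const (c k))) measurableSet_Ici)
  set H : EuclideanSpace ℝ (Fin n) → ℝ≥0∞ := fun x => ∑ k, ENNReal.ofReal (a k) *
    (V k).indicator (fun x => ‖homogeneousKernel Ω (x - c k) - g k x‖ₑ) x with hH
  set f : EuclideanSpace ℝ (Fin n) → ℝ := fun x => ∑ k, a k * boxAverage (z k) (2 * ℓ k) x with hf
  set F : EuclideanSpace ℝ (Fin n) → ℝ := fun x => ∑ k, a k * g k x with hF
  have hindm : ∀ k, Measurable
      ((V k).indicator fun x => ‖homogeneousKernel Ω (x - c k) - g k x‖ₑ) := fun k => by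
    have := hgm k
    exact Measurable.indicator (by fun_prop) (hVm k)
  have hHm : Measurable H := Finset.measurable_fun_sum _ fun k _ => (hindm k).const_mul _
  have hFm : Measurable F := Finset.measurable_fun_sum _ fun k _ => (hgm k).const_mul _
  have hHint : ∫⁻ x, H x ≤ ENNReal.ofReal (X * ∑ k, a k) := by
    rw [lintegral_finsetSum _ fun k _ => (hindm k).const_mul _, Finset.mul_sum,
      ENNReal.ofReal_sum_of_nonneg fun k _ => mul_nonneg hX0 (ha k).le]
    refine Finset.sum_le_sum fun k _ => ?_
    rw [lintegral_const_mul _ (hindm k), lintegral_indicator (hVm k), mul_comm X,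
      ENNReal.ofReal_mul (ha k).le]
    exact mul_le_mul_right (setLIntegral_dirac_sub_boxAverage_le hn hΩ hodd hhom hint hA hsm hε
      (hℓ k) (hεℓ k) hρ (hc k) (hRk k)) _
  have hFint : ∫⁻ x, ‖F x‖ₑ ^ 2 ≤
      ENNReal.ofReal (4 * sphereL1Norm Ω) ^ 2 * ENNReal.ofReal (2 * lam * ∑ k, a k) := by
    have hfi : Integrable f := integrable_finsetSum _ fun k _ =>
      (integrable_boxAverage (z k) (by have := hℓ k; positivity)).const_mul _
    have hfb : ∀ x, |f x| ≤ ∑ k, a k * ((2 * ℓ k) ^ n)⁻¹ := fun x => by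
      refine (Finset.abs_sum_le_sum_abs _ _).trans (Finset.sum_le_sum fun k _ => ?_)
      rw [abs_mul, abs_of_pos (ha k)]
      exact mul_le_mul_of_nonneg_left (abs_boxAverage_le _ (by have := hℓ k; positivity) x) (ha k).le
    have hFf : ∀ x, F x = ∫ u, truncatedKernel Ω ε R u * f (x - u) := fun x => by
      simp only [hF, hf, hg, ← integral_const_mul]
      rw [← integral_finsetSum _ fun k _ => (integrable_truncatedKernel_mul_boxAverage hn1 hΩ hhom
        hint hε hεR (by have := hℓ k; positivity) (z k) x).const_mul _]
      refine integral_congr_ae (.of_forall fun u => ?_)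
      simp only [Finset.mul_sum]
      exact Finset.sum_congr rfl fun k _ => by ring
    simp only [hFf]
    exact (lintegral_sq_truncated_convolution_le hn1 hΩ hodd hhom hint hε hεR hfi hfb).trans
      (mul_le_mul_right hL2 _)
  have hsub : {x | ‖x‖ < ρ ∧ lam < |∑ k, a k * homogeneousKernel Ω (x - c k)|} ⊆
      S ∪ ({x | ENNReal.ofReal (lam / 2) ≤ H x} ∪
        {x | ENNReal.ofReal (lam / 2) ^ 2 ≤ ‖F x‖ₑ ^ 2}) := by
    rintro x ⟨hxρ, hx⟩
    by_contra hcon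
    simp only [mem_union, mem_ofPred_eq, not_or, not_le] at hcon
    obtain ⟨hxS, hxH, hxF⟩ := hcon
    have hxF' : ‖F x‖ₑ < ENNReal.ofReal (lam / 2) := lt_of_pow_lt_pow_left' 2 hxF
    have e : ∑ k, a k * homogeneousKernel Ω (x - c k) =
        ∑ k, a k * (homogeneousKernel Ω (x - c k) - g k x) + F x := by
      rw [hF, ← Finset.sum_add_distrib]
      exact Finset.sum_congr rfl fun k _ => by ring
    have h1 : ‖∑ k, a k * (homogeneousKernel Ω (x - c k) - g k x)‖ₑ ≤ H x := by
      refine (enorm_sum_le _ _).trans (Finset.sum_le_sum fun k _ => ?_)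
      rw [enorm_mul, Real.enorm_of_nonneg (ha k).le, indicator_of_mem (by exact ⟨hxρ, hS x hxS k⟩)]
    have h2 : ENNReal.ofReal lam < ‖∑ k, a k * homogeneousKernel Ω (x - c k)‖ₑ := by
      rw [Real.enorm_eq_ofReal_abs]
      exact (ENNReal.ofReal_lt_ofReal_iff (hlam.trans hx)).2 hx
    have h3 : ENNReal.ofReal lam = ENNReal.ofReal (lam / 2) + ENNReal.ofReal (lam / 2) := by
      rw [← ENNReal.ofReal_add (by positivity) (by positivity), add_halves]
    rw [e, h3] at h2
    exact absurd (h2.trans_le ((enorm_add_le _ _).trans (add_le_add h1 le_rfl)))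
      (not_lt.2 (ENNReal.add_lt_add hxH hxF').le)
  have hcheb : ENNReal.ofReal lam * volume {x | ENNReal.ofReal (lam / 2) ≤ H x} ≤
      ENNReal.ofReal (2 * (X * ∑ k, a k)) := by
    have h := (mul_meas_ge_le_lintegral₀ hHm.aemeasurable (ENNReal.ofReal (lam / 2))).trans hHint
    have e1 : ENNReal.ofReal lam = ENNReal.ofReal 2 * ENNReal.ofReal (lam / 2) := by
      rw [← ENNReal.ofReal_mul zero_le_two]
      congr 1
      ring
    rw [e1, mul_assoc, ENNReal.ofReal_mul zero_le_two]
    exact mul_le_mul_right h _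
  have hcheb2 : ENNReal.ofReal lam * volume {x | ENNReal.ofReal (lam / 2) ^ 2 ≤ ‖F x‖ₑ ^ 2} ≤
      ENNReal.ofReal (128 * sphereL1Norm Ω ^ 2 * ∑ k, a k) := by
    have h := (mul_meas_ge_le_lintegral₀ (hFm.enorm.pow_const 2).aemeasurable
      (ENNReal.ofReal (lam / 2) ^ 2)).trans hFint
    have e1 : ENNReal.ofReal lam = ENNReal.ofReal (4 / lam) * ENNReal.ofReal (lam / 2) ^ 2 := by
      rw [← ENNReal.ofReal_pow (by positivity), ← ENNReal.ofReal_mul (by positivity)]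
      congr 1
      field_simp
      norm_num
    have e2 : ENNReal.ofReal (128 * sphereL1Norm Ω ^ 2 * ∑ k, a k) = ENNReal.ofReal (4 / lam) *
        (ENNReal.ofReal (4 * sphereL1Norm Ω) ^ 2 * ENNReal.ofReal (2 * lam * ∑ k, a k)) := by
      rw [← ENNReal.ofReal_pow (by positivity), ← ENNReal.ofReal_mul (by positivity),
        ← ENNReal.ofReal_mul (by positivity)]
      congr 1
      field_simp
      ring
    nth_rewrite 1 [e1]
    rw [e2, mul_assoc]
    exact mul_le_mul_right h _
  calc _ ≤ ENNReal.ofReal lam * (volume S + (volume {x | ENNReal.ofReal (lam / 2) ≤ H x} +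
        volume {x | ENNReal.ofReal (lam / 2) ^ 2 ≤ ‖F x‖ₑ ^ 2})) :=
        mul_le_mul_right ((measure_mono hsub).trans ((measure_union_le _ _).trans
          (add_le_add le_rfl (measure_union_le _ _)))) _
    _ ≤ ENNReal.ofReal (Real.exp 2 * ∑ k, a k) + (ENNReal.ofReal (2 * (X * ∑ k, a k)) +
        ENNReal.ofReal (128 * sphereL1Norm Ω ^ 2 * ∑ k, a k)) := by
        rw [mul_add, mul_add]
        exact add_le_add hSv (add_le_add hcheb hcheb2)
    _ = _ := by
        rw [← ENNReal.ofReal_add (by positivity) (by positivity),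
          ← ENNReal.ofReal_add (by positivity) (by positivity)]
        congr 1
        rw [hX]
        ring

end WeakType

/-- Weak-type bound for singular integrals (with odd, degree-zero homogeneous,
mean-zero angular part `Ω` satisfying a Hörmander-type smoothness condition)
applied to finite nonnegative combinations of Dirac masses:
`λ |{|Tν| > λ}| ≤ (C₆ + (C₇ max{1,‖Ω‖₁} + C₈ log n)‖Ω‖₁) ∑ aₖ`. -/
theorem weak_type_diracs_general_log_bound :
    ∀ A : ℝ, 1 ≤ A → ∃ C₆ C₇ C₈ : ℝ, 0 < C₆ ∧ 0 < C₇ ∧ 0 < C₈ ∧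
      ∀ (n : ℕ), 2 ≤ n →
      ∀ Ω : EuclideanSpace ℝ (Fin n) → ℝ, Measurable Ω →
      (∀ x : EuclideanSpace ℝ (Fin n), x ≠ 0 → Ω (-x) = -Ω x) →
      (∀ (x : EuclideanSpace ℝ (Fin n)), x ≠ 0 → ∀ δ : ℝ, 0 < δ → Ω (δ • x) = Ω x) →
      Integrable (fun θ : sphere (0 : EuclideanSpace ℝ (Fin n)) 1 => Ω θ)
        (volume : Measure (EuclideanSpace ℝ (Fin n))).toSphere →
      (∫ θ : sphere (0 : EuclideanSpace ℝ (Fin n)) 1, Ω θ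
          ∂(volume : Measure (EuclideanSpace ℝ (Fin n))).toSphere) = 0 →
      (∀ ξ : EuclideanSpace ℝ (Fin n), ‖ξ‖ = 1 → ∀ δ : ℝ, 0 < δ → δ < 1 / n →
        (∫ θ : sphere (0 : EuclideanSpace ℝ (Fin n)) 1, |Ω ((θ : EuclideanSpace ℝ (Fin n)) - δ • ξ) - Ω θ|
            ∂(volume : Measure (EuclideanSpace ℝ (Fin n))).toSphere) ≤
          A * n * δ * ∫ θ : sphere (0 : EuclideanSpace ℝ (Fin n)) 1, |Ω θ|
            ∂(volume : Measure (EuclideanSpace ℝ (Fin n))).toSphere) →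
      ∀ (N : ℕ) (c : Fin N → EuclideanSpace ℝ (Fin n)) (a : Fin N → ℝ),
        (∀ k, 0 < a k) →
      ∀ lam : ℝ, 0 < lam →
        ENNReal.ofReal lam *
            volume {x : EuclideanSpace ℝ (Fin n) |
              lam < |∑ k, a k * (Ω (x - c k) / ‖x - c k‖ ^ n)|} ≤
          ENNReal.ofReal
            ((C₆ +
                (C₇ * max 1 (∫ θ : sphere (0 : EuclideanSpace ℝ (Fin n)) 1, |Ω θ|
                    ∂(volume : Measure (EuclideanSpace ℝ (Fin n))).toSphere) +
                  C₈ * Real.log n) *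
                  (∫ θ : sphere (0 : EuclideanSpace ℝ (Fin n)) 1, |Ω θ|
                    ∂(volume : Measure (EuclideanSpace ℝ (Fin n))).toSphere)) *
              ∑ k, a k) := by
  intro A hA
  refine ⟨Real.exp 2, 8 * A + 128, 24, Real.exp_pos 2, by linarith, by norm_num, ?_⟩
  intro n hn Ω hΩ hodd hhom hint _ hsm N c a ha lam hlam
  change ENNReal.ofReal lam *
      volume {x | lam < |∑ k, a k * homogeneousKernel Ω (x - c k)|} ≤
    ENNReal.ofReal ((Real.exp 2 + ((8 * A + 128) * max 1 (sphereL1Norm Ω) + 24 * Real.log n) *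
      sphereL1Norm Ω) * ∑ k, a k)
  have hM : 0 ≤ sphereL1Norm Ω := sphereL1Norm_nonneg
  have hunion : {x | lam < |∑ k, a k * homogeneousKernel Ω (x - c k)|} =
      ⋃ m : ℕ, {x | ‖x‖ < m ∧ lam < |∑ k, a k * homogeneousKernel Ω (x - c k)|} := by
    ext x
    simp only [mem_iUnion, mem_ofPred_eq, exists_and_right]
    exact ⟨fun h => ⟨exists_nat_gt _, h⟩, fun h => h.2⟩
  have hmono : Monotone fun m : ℕ =>
      {x | ‖x‖ < m ∧ lam < |∑ k, a k * homogeneousKernel Ω (x - c k)|} :=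
    fun m m' hm x hx => ⟨hx.1.trans_le (Nat.cast_le.2 hm), hx.2⟩
  rw [hunion, hmono.measure_iUnion, ENNReal.mul_iSup]
  refine iSup_le fun m => (weak_type_diracs_ball hn hΩ hodd hhom hint hA hsm c ha hlam
    (Nat.cast_nonneg m)).trans (ENNReal.ofReal_le_ofReal ?_)
  refine mul_le_mul_of_nonneg_right ?_ (Finset.sum_nonneg fun k _ => (ha k).le)
  have h1 : sphereL1Norm Ω ≤ max 1 (sphereL1Norm Ω) * sphereL1Norm Ω :=
    le_mul_of_one_le_left hM (le_max_left _ _)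
  have h2 : sphereL1Norm Ω ^ 2 ≤ max 1 (sphereL1Norm Ω) * sphereL1Norm Ω := by
    rw [sq]
    exact mul_le_mul_of_nonneg_right (le_max_right _ _) hM
  nlinarith [mul_le_mul_of_nonneg_left h1 (by linarith : 0 ≤ 8 * A)]
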